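/- Let L_0, L_1 and L_∞ be three distinct rays emanating from the origin. Then there is no transcendental meromorphic function f on ℂ of order less than 1 such that all but finitely many zeros of f lie on L_0, all but finitely many 1-points of f lie on L_1, and all but finitely many poles of f lie on L_∞. -/

import Mathlib

open Complex Filter Set Topology

noncomputable section

/-- The open ray emanating from the origin with direction angle `θ`. -/
def Ray (θ : ℝ) : Set ℂ :=
  {z : ℂ | ∃ t : ℝ, 0 < t ∧ z = (t : ℂ) * Complex.exp ((θ : ℂ) * Complex.I)}

/-- `f` is meromorphic on the open set `U` with pole set `P`. -/
def MeromOn (f : ℂ → ℂ) (P : Set ℂ) (U : Set ℂ) : Prop :=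
  P ⊆ U ∧ AnalyticOnNhd ℂ f (U \ P) ∧
    (∀ p ∈ P, Tendsto (fun z => ‖f z‖) (𝓝[≠] p) atTop) ∧
    ∀ z ∈ U, ¬ AccPt z (𝓟 P)

/-- `f` (meromorphic on `ℂ` with pole set `P`) is a rational function. -/
def IsRationalFn (f : ℂ → ℂ) (P : Set ℂ) : Prop :=
  ∃ p q : Polynomial ℂ, q ≠ 0 ∧ ∀ z ∉ P, q.eval z ≠ 0 → f z = p.eval z / q.eval z

/-- The order of the pole of `f` at `z`: the least `m` such that near `z` (punctured),
`f = h / (· - z)^m` with `h` analytic and nonvanishing at `z`. -/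
def poleOrder (f : ℂ → ℂ) (z : ℂ) : ℕ :=
  sInf {m : ℕ | ∃ h : ℂ → ℂ, AnalyticAt ℂ h z ∧ h z ≠ 0 ∧
    ∀ᶠ w in 𝓝[≠] z, f w = h w / (w - z) ^ m}

/-- The number of poles of `f` of modulus at most `t`, counted with multiplicity. -/
def nPoles (f : ℂ → ℂ) (P : Set ℂ) (t : ℝ) : ℝ :=
  ∑ᶠ z ∈ {z : ℂ | ‖z‖ ≤ t ∧ z ∈ P}, (poleOrder f z : ℝ)

/-- The integrated counting function `N(r, f)` of the poles of `f`. -/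
def NPoles (f : ℂ → ℂ) (P : Set ℂ) (r : ℝ) : ℝ :=
  (∫ t in (0:ℝ)..r, (nPoles f P t - nPoles f P 0) / t) + nPoles f P 0 * Real.log r

/-- The Nevanlinna proximity function `m(r, f)`. -/
def mProx (f : ℂ → ℂ) (r : ℝ) : ℝ :=
  (2 * Real.pi)⁻¹ *
    ∫ θ in (0:ℝ)..(2 * Real.pi), Real.log (max 1 ‖f ((r : ℂ) * Complex.exp ((θ : ℂ) * Complex.I))‖)

/-- The Nevanlinna characteristic `T(r, f) = m(r, f) + N(r, f)`. -/
def Tchar (f : ℂ → ℂ) (P : Set ℂ) (r : ℝ) : ℝ := mProx f r + NPoles f P r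

/-- The order `ρ(f) = limsup_{r → ∞} log T(r, f) / log r` of a meromorphic function. -/
def meromOrder (f : ℂ → ℂ) (P : Set ℂ) : EReal :=
  Filter.limsup (fun r : ℝ => ((Real.log (Tchar f P r) / Real.log r : ℝ) : EReal)) Filter.atTop

/-- balanced unit vectors -/
lemma balanced_aux (q1 q2 : ℂ) (h1 : ‖q1‖ = 1) (h2 : ‖q2‖ = 1) (x y : ℝ)
    (hx0 : 0 ≤ x) (hx1 : x ≤ 1) (hy0 : 0 ≤ y) (hy1 : y ≤ 1)
    (h : 1 + (x : ℂ) * q1 + y * q2 = 0) :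
    q1.re + q2.re + (q1.re * q2.re + q1.im * q2.im) ≤ -1 := by
  have e1 : q1.re ^ 2 + q1.im ^ 2 = 1 := by
    have := Complex.sq_norm q1
    rw [h1, Complex.normSq_apply] at this; nlinarith
  have e2 : q2.re ^ 2 + q2.im ^ 2 = 1 := by
    have := Complex.sq_norm q2
    rw [h2, Complex.normSq_apply] at this; nlinarith
  have hr := congrArg Complex.re h
  have hi := congrArg Complex.im h
  simp at hr hi
  set c1 := q1.re
  set s1 := q1.im
  set c2 := q2.re
  set s2 := q2.im
  have hys : y ^ 2 = 1 + 2 * x * c1 + x ^ 2 := by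
    have : y ^ 2 = (y * c2) ^ 2 + (y * s2) ^ 2 := by linear_combination (-y^2) * e2
    have a1 : y * c2 = -(1 + x * c1) := by linarith
    have a2 : y * s2 = -(x * s1) := by linarith
    rw [this, a1, a2]; linear_combination x^2 * e1
  have hxs : x ^ 2 = 1 + 2 * y * c2 + y ^ 2 := by
    have : x ^ 2 = (x * c1) ^ 2 + (x * s1) ^ 2 := by linear_combination (-x^2) * e1
    have a1 : x * c1 = -(1 + y * c2) := by linarith
    have a2 : x * s1 = -(y * s2) := by linarith
    rw [this, a1, a2]; linear_combination y^2 * e2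
  have b1 : -1 ≤ c1 := by nlinarith
  have b2 : -1 ≤ c2 := by nlinarith
  have b1' : c1 ≤ 1 := by nlinarith
  have b2' : c2 ≤ 1 := by nlinarith
  rcases hx0.eq_or_lt with hx | hx
  · subst hx
    have hc2 : c2 = -1 := by nlinarith
    have hs2 : s2 = 0 := by
      rw [hc2] at e2
      have : s2 ^ 2 = 0 := by linarith
      exact pow_eq_zero_iff (two_ne_zero) |>.1 this
    rw [hc2, hs2]; linarith
  rcases hy0.eq_or_lt with hy | hy
  · subst hy
    have hc1 : c1 = -1 := by nlinarith
    have hs1 : s1 = 0 := by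
      rw [hc1] at e1
      have : s1 ^ 2 = 0 := by linarith
      exact pow_eq_zero_iff (two_ne_zero) |>.1 this
    rw [hc1, hs1]; linarith
  have n1 : c1 ≤ 0 := by
    by_contra hc; push Not at hc
    nlinarith [mul_pos hx hc, mul_pos hx hx]
  have n2 : c2 ≤ 0 := by
    by_contra hc; push Not at hc
    nlinarith [mul_pos hy hc, mul_pos hy hy]
  have ss : s1 * s2 ≤ 0 := by
    by_contra hc; push Not at hc
    have : 0 < (x * s1) * (y * s2) := by
      have := mul_pos (mul_pos hx hy) hc; nlinarith
    have a2 : y * s2 = -(x * s1) := by linarith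
    rw [a2] at this; nlinarith [sq_nonneg (x * s1)]
  have key : (1 + c1) * (1 + c2) ≤ -(s1 * s2) := by
    apply abs_le_of_sq_le_sq' _ (by linarith) |>.2
    have e1' : s1 ^ 2 = (1 - c1) * (1 + c1) := by linarith
    have e2' : s2 ^ 2 = (1 - c2) * (1 + c2) := by linarith
    have : (-(s1 * s2)) ^ 2 = ((1 - c1) * (1 - c2)) * ((1 + c1) * (1 + c2)) := by
      calc _ = s1 ^ 2 * s2 ^ 2 := by ring
        _ = _ := by rw [e1', e2']; ring
    rw [this, sq]
    apply mul_le_mul_of_nonneg_right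
    · nlinarith
    · apply mul_nonneg <;> linarith
  nlinarith

/-- If the largest weight is the first. -/
lemma balanced_aux2 (q0 q1 q2 : ℂ) (h0 : ‖q0‖ = 1) (h1 : ‖q1‖ = 1) (h2 : ‖q2‖ = 1)
    (w0 w1 w2 : ℝ) (hw0 : 0 < w0)
    (hw1 : 0 ≤ w1) (hw2 : 0 ≤ w2) (h10 : w1 ≤ w0) (h20 : w2 ≤ w0)
    (h : (w0 : ℂ) * q0 + w1 * q1 + w2 * q2 = 0) :
    (q0 * (starRingEnd ℂ) q1 + q1 * (starRingEnd ℂ) q2 + q2 * (starRingEnd ℂ) q0).re ≤ -1 := by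
  have hc : q0 * (starRingEnd ℂ) q0 = 1 := by
    rw [Complex.mul_conj, Complex.normSq_eq_norm_sq, h0]; simp
  have hw0' : (w0 : ℂ) ≠ 0 := by exact_mod_cast hw0.ne'
  have := balanced_aux (q1 * (starRingEnd ℂ) q0) (q2 * (starRingEnd ℂ) q0) (by simp [h0, h1]) (by simp [h0, h2])
    (w1 / w0) (w2 / w0) (by positivity) ((div_le_one hw0).2 h10) (by positivity)
    ((div_le_one hw0).2 h20) (by
      have e : (1 : ℂ) + ((w1 / w0 : ℝ) : ℂ) * (q1 * (starRingEnd ℂ) q0) + ((w2 / w0 : ℝ) : ℂ) * (q2 * (starRingEnd ℂ) q0)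
        = (1 - q0 * (starRingEnd ℂ) q0) + (starRingEnd ℂ) q0 / w0 * ((w0 : ℂ) * q0 + w1 * q1 + w2 * q2) := by
        push_cast; field_simp; ring
      rw [e, h, hc]; simp)
  have e : (q1 * (starRingEnd ℂ) q0).re * (q2 * (starRingEnd ℂ) q0).re + (q1 * (starRingEnd ℂ) q0).im * (q2 * (starRingEnd ℂ) q0).im
      = (q1 * (starRingEnd ℂ) q2).re := by
    have : ((q1 * (starRingEnd ℂ) q0) * (starRingEnd ℂ) (q2 * (starRingEnd ℂ) q0)) = q1 * (starRingEnd ℂ) q2 := by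
      simp; linear_combination (q1 * (starRingEnd ℂ) q2) * hc
    rw [← this]; simp [Complex.mul_re]; ring
  rw [e] at this
  have e2 : (q0 * (starRingEnd ℂ) q1).re = (q1 * (starRingEnd ℂ) q0).re := by
    simp [Complex.mul_re]; ring
  simp only [Complex.add_re] at *
  linarith

lemma balanced (q0 q1 q2 : ℂ) (h0 : ‖q0‖ = 1) (h1 : ‖q1‖ = 1) (h2 : ‖q2‖ = 1)
    (w0 w1 w2 : ℝ) (hw0 : 0 ≤ w0)
    (hw1 : 0 ≤ w1) (hw2 : 0 ≤ w2) (hne : 0 < w0 ∨ 0 < w1 ∨ 0 < w2)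
    (h : (w0 : ℂ) * q0 + w1 * q1 + w2 * q2 = 0) :
    (q0 * (starRingEnd ℂ) q1 + q1 * (starRingEnd ℂ) q2 + q2 * (starRingEnd ℂ) q0).re ≤ -1 := by
  have hs : ∀ a b : ℂ, (a * (starRingEnd ℂ) b).re = (b * (starRingEnd ℂ) a).re := by
    intro a b; simp [Complex.mul_re]; ring
  by_cases a : w1 ≤ w0 ∧ w2 ≤ w0
  · exact balanced_aux2 q0 q1 q2 h0 h1 h2 w0 w1 w2 (by grind) hw1 hw2 a.1 a.2 h
  by_cases b : w0 ≤ w1 ∧ w2 ≤ w1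
  · have := balanced_aux2 q1 q2 q0 h1 h2 h0 w1 w2 w0 (by grind) hw2 hw0 b.2 b.1
      (by rw [← h]; ring)
    simp only [Complex.add_re] at *; linarith
  have := balanced_aux2 q2 q0 q1 h2 h0 h1 w2 w0 w1 (by grind) hw0 hw1 (by grind) (by grind)
      (by rw [← h]; ring)
  simp only [Complex.add_re] at *; linarith

/-- The class of coefficient sequences with asymptotic phase. -/
def PhaseSeq (ω : ℂ) (x : ℕ → ℂ) : Prop :=
  (∃ M, ∀ N ≥ M, x N = 0) ∨
  ∃ y : ℕ → ℂ, ∃ η : ℂ, (∀ N, x N = ω ^ N * y N) ∧ (∀ᶠ N in atTop, y N ≠ 0) ∧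
    Tendsto (fun N => y (N + 1) / y N) atTop (𝓝 0) ∧
    Tendsto (fun N => y N / (‖y N‖ : ℂ)) atTop (𝓝 η)

lemma PhaseSeq.exists_phase {ω : ℂ} {x : ℕ → ℂ} (hω : ‖ω‖ = 1) (h : PhaseSeq ω x) :
    ∃ q : ℕ → ℂ, ∃ η : ℂ, ‖η‖ = 1 ∧ (∀ᶠ N in atTop, ‖q N‖ = 1 ∧ x N = ‖x N‖ * q N) ∧
      Tendsto (fun N => q N - η * ω ^ N) atTop (𝓝 0) := by
  rcases h with ⟨M, hM⟩ | ⟨y, η, hxy, hy, -, hη⟩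
  · refine ⟨fun N => ω ^ N, 1, by simp, ?_, by simp⟩
    filter_upwards [eventually_ge_atTop M] with N hN
    simp [hω, hM N hN]
  · have hn : ∀ N, y N ≠ 0 → ‖y N / (‖y N‖ : ℂ)‖ = 1 := by
      intro N hN
      simp [norm_ne_zero_iff.2 hN]
    refine ⟨fun N => ω ^ N * (y N / (‖y N‖ : ℂ)), η, ?_, ?_, ?_⟩
    · refine tendsto_nhds_unique hη.norm ?_
      refine tendsto_const_nhds.congr' ?_
      filter_upwards [hy] with N hN
      rw [hn N hN]
    · filter_upwards [hy] with N hN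
      refine ⟨by rw [norm_mul, hn N hN]; simp [hω], ?_⟩
      have : (‖y N‖ : ℂ) ≠ 0 := by simpa using hN
      rw [hxy]; simp [hω]; field_simp
    · rw [tendsto_zero_iff_norm_tendsto_zero]
      have : Tendsto (fun N => ‖y N / (‖y N‖ : ℂ) - η‖) atTop (𝓝 0) := by
        rw [← tendsto_zero_iff_norm_tendsto_zero]
        simpa using hη.sub_const η
      refine this.congr fun N => ?_
      have : ω ^ N * (y N / (‖y N‖ : ℂ)) - η * ω ^ N = ω ^ N * (y N / (‖y N‖ : ℂ) - η) := by ring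
      rw [this, norm_mul]; simp [hω]

lemma geom_bdd {l : ℂ} (hl : ‖l‖ = 1) (h1 : l ≠ 1) (c : ℂ) (M : ℕ) :
    ‖∑ i ∈ Finset.range M, c * l ^ i‖ ≤ ‖c‖ * (2 / ‖l - 1‖) := by
  rw [← Finset.mul_sum, geom_sum_eq h1, norm_mul, norm_div]
  gcongr
  refine (norm_sub_le _ _).trans ?_
  simp [hl]; norm_num

lemma tendsto_cross {ω ω' η η' : ℂ} {q q' : ℕ → ℂ} (hω' : ‖ω'‖ = 1)
    (hη : ‖η‖ = 1) (hω : ‖ω‖ = 1) (hq' : ∀ᶠ N in atTop, ‖q' N‖ = 1)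
    (h : Tendsto (fun N => q N - η * ω ^ N) atTop (𝓝 0))
    (h' : Tendsto (fun N => q' N - η' * ω' ^ N) atTop (𝓝 0)) :
    Tendsto (fun N => q N * (starRingEnd ℂ) (q' N) - (η * (starRingEnd ℂ) η') * (ω * (starRingEnd ℂ) ω') ^ N) atTop (𝓝 0) := by
  rw [tendsto_zero_iff_norm_tendsto_zero] at *
  refine squeeze_zero' (Eventually.of_forall fun _ => norm_nonneg _) ?_ (by simpa using h.add h')
  filter_upwards [hq'] with N hN
  have : q N * (starRingEnd ℂ) (q' N) - (η * (starRingEnd ℂ) η') * (ω * (starRingEnd ℂ) ω') ^ N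
    = (q N - η * ω ^ N) * (starRingEnd ℂ) (q' N) + η * ω ^ N * (starRingEnd ℂ) (q' N - η' * ω' ^ N) := by
    simp; ring
  rw [this]
  refine (norm_add_le _ _).trans ?_
  simp only [norm_mul, RCLike.norm_conj, hN, hη, norm_pow, hω]
  simp

lemma three_phase {ω0 ω1 ω2 : ℂ} (h0 : ‖ω0‖ = 1) (h1 : ‖ω1‖ = 1) (h2 : ‖ω2‖ = 1)
    (h01 : ω0 ≠ ω1) (h12 : ω1 ≠ ω2) (h20 : ω2 ≠ ω0) {x0 x1 x2 : ℕ → ℂ}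
    (p0 : PhaseSeq ω0 x0) (p1 : PhaseSeq ω1 x1) (p2 : PhaseSeq ω2 x2)
    (hs : ∀ N, x0 N + x1 N + x2 N = 0)
    (hne : (∀ᶠ N in atTop, x0 N ≠ 0) ∨ (∀ᶠ N in atTop, x1 N ≠ 0) ∨ (∀ᶠ N in atTop, x2 N ≠ 0)) :
    False := by
  obtain ⟨q0, η0, e0, ev0, t0⟩ := p0.exists_phase h0
  obtain ⟨q1, η1, e1, ev1, t1⟩ := p1.exists_phase h1
  obtain ⟨q2, η2, e2, ev2, t2⟩ := p2.exists_phase h2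
  have hne' : ∀ᶠ N in atTop, 0 < ‖x0 N‖ ∨ 0 < ‖x1 N‖ ∨ 0 < ‖x2 N‖ := by
    simp only [norm_pos_iff]
    rcases hne with h | h | h
    · filter_upwards [h] with N hN using Or.inl hN
    · filter_upwards [h] with N hN using Or.inr (Or.inl hN)
    · filter_upwards [h] with N hN using Or.inr (Or.inr hN)
  have hbal : ∀ᶠ N in atTop,
      (q0 N * (starRingEnd ℂ) (q1 N) + q1 N * (starRingEnd ℂ) (q2 N) + q2 N * (starRingEnd ℂ) (q0 N)).re ≤ -1 := by
    filter_upwards [hne', ev0, ev1, ev2] with N hN a b c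
    refine balanced _ _ _ a.1 b.1 c.1 ‖x0 N‖ ‖x1 N‖ ‖x2 N‖ (norm_nonneg _) (norm_nonneg _)
      (norm_nonneg _) hN ?_
    rw [← a.2, ← b.2, ← c.2, hs]
  have T := ((tendsto_cross h1 e0 h0 (ev1.mono fun _ h => h.1) t0 t1).add
    (tendsto_cross h2 e1 h1 (ev2.mono fun _ h => h.1) t1 t2)).add
    (tendsto_cross h0 e2 h2 (ev0.mono fun _ h => h.1) t2 t0)
  have hl : ∀ {a b : ℂ}, ‖a‖ = 1 → ‖b‖ = 1 → a ≠ b → ‖a * (starRingEnd ℂ) b‖ = 1 ∧ a * (starRingEnd ℂ) b ≠ 1 := by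
    intro a b ha hb hab
    refine ⟨by simp [ha, hb], fun h => hab ?_⟩
    have hc : b * (starRingEnd ℂ) b = 1 := by
      rw [Complex.mul_conj, Complex.normSq_eq_norm_sq, hb]; simp
    calc a = a * (b * (starRingEnd ℂ) b) := by rw [hc, mul_one]
      _ = (a * (starRingEnd ℂ) b) * b := by ring
      _ = b := by rw [h, one_mul]
  obtain ⟨l01, l01'⟩ := hl h0 h1 h01
  obtain ⟨l12, l12'⟩ := hl h1 h2 h12
  obtain ⟨l20, l20'⟩ := hl h2 h0 h20
  set F : ℕ → ℂ := fun N => (η0 * (starRingEnd ℂ) η1) * (ω0 * (starRingEnd ℂ) ω1) ^ N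
    + (η1 * (starRingEnd ℂ) η2) * (ω1 * (starRingEnd ℂ) ω2) ^ N + (η2 * (starRingEnd ℂ) η0) * (ω2 * (starRingEnd ℂ) ω0) ^ N with hF
  have hFe : ∀ᶠ N in atTop, (F N).re ≤ -(1/2) := by
    have hTn := T.norm
    simp only [add_zero, norm_zero] at hTn
    have T' := hTn.eventually_lt_const (show (0:ℝ) < 1 / 2 by norm_num)
    filter_upwards [T', hbal] with N a b
    have := (abs_lt.1 (lt_of_le_of_lt (Complex.abs_re_le_norm _) a)).1
    simp only [hF, Complex.add_re, Complex.sub_re] at *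
    linarith
  obtain ⟨N0, hN0⟩ := eventually_atTop.1 hFe
  have hbd : ∃ B : ℝ, ∀ M, ‖∑ i ∈ Finset.range M, F i‖ ≤ B := by
    refine ⟨‖η0 * (starRingEnd ℂ) η1‖ * (2 / ‖ω0 * (starRingEnd ℂ) ω1 - 1‖)
      + ‖η1 * (starRingEnd ℂ) η2‖ * (2 / ‖ω1 * (starRingEnd ℂ) ω2 - 1‖)
      + ‖η2 * (starRingEnd ℂ) η0‖ * (2 / ‖ω2 * (starRingEnd ℂ) ω0 - 1‖), fun M => ?_⟩
    simp only [hF, Finset.sum_add_distrib]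
    exact norm_add₃_le.trans (add_le_add (add_le_add (geom_bdd l01 l01' _ M)
      (geom_bdd l12 l12' _ M)) (geom_bdd l20 l20' _ M))
  obtain ⟨B, hB⟩ := hbd
  have hup : ∀ K : ℕ, (∑ i ∈ Finset.range (N0 + K), F i).re ≤ B - K / 2 := by
    intro K
    induction K with
    | zero => simpa using (Complex.re_le_norm _).trans (hB N0)
    | succ K ih =>
      rw [← add_assoc, Finset.sum_range_succ, Complex.add_re]
      have := hN0 (N0 + K) (by omega)
      push_cast; linarith
  obtain ⟨K, hK⟩ := exists_nat_gt (4 * B)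
  have a := hup K
  have b := (abs_le.1 ((Complex.abs_re_le_norm _).trans (hB (N0 + K)))).1
  linarith

/-- Polynomials with nonnegative coefficients, constant term one and a decay condition. -/
def GoodPoly (p : Polynomial ℝ) (σ : ℝ) : Prop :=
  (∀ N, 0 ≤ p.coeff N) ∧ p.coeff 0 = 1 ∧ ∀ N : ℕ, ((N : ℝ) + 1) * p.coeff (N + 1) ≤ σ * p.coeff N

lemma goodPoly_one : GoodPoly 1 0 := by
  refine ⟨fun N => ?_, by simp, fun N => by simp [Polynomial.coeff_one]⟩
  rw [Polynomial.coeff_one]; split_ifs <;> simp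

lemma GoodPoly.mul_lin {p : Polynomial ℝ} {σ : ℝ} (h : GoodPoly p σ) {a : ℝ} (ha : 0 ≤ a) :
    GoodPoly (p * (1 + Polynomial.C a * Polynomial.X)) (σ + a) := by
  have e0 : (p * (1 + Polynomial.C a * Polynomial.X)).coeff 0 = p.coeff 0 := by
    simp [mul_add]
  have e1 : ∀ N, (p * (1 + Polynomial.C a * Polynomial.X)).coeff (N + 1) = p.coeff (N + 1) + a * p.coeff N := by
    intro N
    rw [mul_add, mul_one, Polynomial.coeff_add, mul_left_comm, Polynomial.coeff_C_mul, Polynomial.coeff_mul_X]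
  obtain ⟨h1, h2, h3⟩ := h
  refine ⟨fun N => ?_, by rw [e0, h2], fun N => ?_⟩
  · cases N with
    | zero => rw [e0]; exact h1 0
    | succ N => rw [e1]; have := h1 (N + 1); have := h1 N; positivity
  · cases N with
    | zero =>
      rw [e1, e0]; have := h3 0; simp at this ⊢; rw [h2] at *; linarith
    | succ N =>
      rw [e1, e1]
      have a1 := h3 N
      have a2 := h3 (N + 1)
      have := mul_le_mul_of_nonneg_left a1 ha
      have := mul_nonneg (mul_nonneg ha ha) (h1 N)
      push_cast at *
      nlinarith

lemma GoodPoly.mul_lin_pow {p : Polynomial ℝ} {σ : ℝ} (h : GoodPoly p σ) {a : ℝ} (ha : 0 ≤ a) (k : ℕ) :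
    GoodPoly (p * (1 + Polynomial.C a * Polynomial.X) ^ k) (σ + k * a) := by
  induction k with
  | zero => simpa using h
  | succ k ih =>
    have := ih.mul_lin ha
    convert this using 1
    · ring
    · push_cast; ring

lemma goodPoly_prod (S : Finset ℂ) (m : ℂ → ℕ) (a : ℂ → ℝ) (ha : ∀ u, 0 ≤ a u) :
    GoodPoly (∏ u ∈ S, (1 + Polynomial.C (a u) * Polynomial.X) ^ m u) (∑ u ∈ S, m u * a u) := by
  classical
  induction S using Finset.induction_on with
  | empty => simpa using goodPoly_one
  | insert u S hu ih =>
    have := ih.mul_lin_pow (ha u) (m u)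
    rw [Finset.prod_insert hu, Finset.sum_insert hu]
    rw [mul_comm (∏ u ∈ S, (1 + Polynomial.C (a u) * Polynomial.X) ^ m u),
      add_comm (∑ u ∈ S, (m u : ℝ) * a u)] at this
    exact this

lemma GoodPoly.coeff_le {p : Polynomial ℝ} {σ τ : ℝ} (h : GoodPoly p σ) (hτ : σ ≤ τ) (N : ℕ) :
    p.coeff N ≤ τ ^ N / N.factorial := by
  have hτ0 : 0 ≤ τ := by
    have := h.2.2 0
    have h1 := h.1 1
    rw [h.2.1] at this; simp at this; linarith
  induction N with
  | zero => simp [h.2.1]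
  | succ N ih =>
    have a := h.2.2 N
    have : ((N : ℝ) + 1) * p.coeff (N + 1) ≤ τ * (τ ^ N / N.factorial) :=
      a.trans (mul_le_mul hτ ih (h.1 N) hτ0)
    rw [Nat.factorial_succ, le_div_iff₀ (by positivity)]
    push_cast
    have hf : (0:ℝ) < N.factorial := by positivity
    calc p.coeff (N + 1) * ((N + 1) * N.factorial) = (((N : ℝ) + 1) * p.coeff (N + 1)) * N.factorial := by ring
      _ ≤ (τ * (τ ^ N / N.factorial)) * N.factorial := by gcongr
      _ = τ ^ (N + 1) := by field_simp; ring

/-- Limits of products of `1 + a u w`. -/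
lemma pure_limit (S : ℕ → Finset ℂ) (hS : Monotone S) (m : ℂ → ℕ) (a : ℂ → ℝ) (ha : ∀ u, 0 ≤ a u)
    (τ : ℝ) (hτ : ∀ n, ∑ u ∈ S n, m u * a u ≤ τ) :
    ∃ (s : ℕ → ℝ) (h : ℂ → ℂ), s 0 = 1 ∧ (∀ N, 0 ≤ s N) ∧
      (∀ N : ℕ, ((N : ℝ) + 1) * s (N + 1) ≤ τ * s N) ∧
      (∀ w, HasSum (fun N => (s N : ℂ) * w ^ N) (h w)) ∧
      ∀ w : ℂ, Tendsto (fun n => ∏ u ∈ S n, (1 + a u * w) ^ m u) atTop (𝓝 (h w)) := by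
  classical
  set p : ℕ → Polynomial ℝ := fun n => ∏ u ∈ S n, (1 + Polynomial.C (a u) * Polynomial.X) ^ m u with hp
  have hg : ∀ n, GoodPoly (p n) (∑ u ∈ S n, m u * a u) := fun n => goodPoly_prod _ _ _ ha
  have hb : ∀ n N, (p n).coeff N ≤ τ ^ N / N.factorial := fun n N => (hg n).coeff_le (hτ n) N
  have hmono : ∀ N, Monotone fun n => (p n).coeff N := by
    intro N k l hkl
    have e : p l = p k * ∏ u ∈ S l \ S k, (1 + Polynomial.C (a u) * Polynomial.X) ^ m u := by
      rw [hp]; simp only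
      rw [mul_comm, Finset.prod_sdiff (hS hkl)]
    have hq := goodPoly_prod (S l \ S k) m a ha
    set q := ∏ u ∈ S l \ S k, (1 + Polynomial.C (a u) * Polynomial.X) ^ m u
    show (p k).coeff N ≤ (p l).coeff N
    rw [e, Polynomial.coeff_mul]
    have := Finset.single_le_sum (s := Finset.HasAntidiagonal.antidiagonal N) (f := fun x => (p k).coeff x.1 * q.coeff x.2)
      (fun x _ => mul_nonneg ((hg k).1 _) (hq.1 _)) (a := (N, 0)) (by simp)
    simpa [hq.2.1] using this
  have hconv : ∀ N, ∃ l, Tendsto (fun n => (p n).coeff N) atTop (𝓝 l) := fun N =>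
    ⟨_, tendsto_atTop_ciSup (hmono N) ⟨τ ^ N / N.factorial, by rintro _ ⟨n, rfl⟩; exact hb n N⟩⟩
  choose s hs using hconv
  have hs0 : ∀ N, 0 ≤ s N := fun N => ge_of_tendsto' (hs N) fun n => (hg n).1 N
  have hτ0 : 0 ≤ τ := (Finset.sum_nonneg fun u _ => mul_nonneg (Nat.cast_nonneg _) (ha u)).trans (hτ 0)
  have hsb : ∀ N, s N ≤ τ ^ N / N.factorial := fun N => le_of_tendsto' (hs N) fun n => hb n N
  have hsum : ∀ w : ℂ, Summable fun N : ℕ => τ ^ N / N.factorial * ‖w‖ ^ N := by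
    intro w
    refine (Real.summable_pow_div_factorial (τ * ‖w‖)).congr fun N => ?_
    rw [mul_pow]; ring
  have hsm : ∀ w : ℂ, Summable fun N : ℕ => (s N : ℂ) * w ^ N := by
    intro w
    refine Summable.of_norm_bounded (hsum w) fun N => ?_
    rw [norm_mul, norm_pow, Complex.norm_real, Real.norm_of_nonneg (hs0 N)]
    gcongr; exact hsb N
  refine ⟨s, fun w => ∑' N, (s N : ℂ) * w ^ N, ?_, hs0, fun N => ?_, fun w => (hsm w).hasSum, fun w => ?_⟩
  · exact tendsto_nhds_unique (hs 0) (by simp [(hg _).2.1])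
  · refine le_of_tendsto_of_tendsto' ((hs (N + 1)).const_mul _) ((hs N).const_mul τ) fun n => ?_
    exact ((hg n).2.2 N).trans (mul_le_mul_of_nonneg_right (hτ n) ((hg n).1 N))
  · have e : ∀ n, ∏ u ∈ S n, (1 + (a u : ℂ) * w) ^ m u = ∑' N, ((p n).coeff N : ℂ) * w ^ N := by
      intro n
      have e1 : ((p n).map (algebraMap ℝ ℂ)).eval w = ∏ u ∈ S n, (1 + (a u : ℂ) * w) ^ m u := by
        simp [hp, Polynomial.map_prod, Polynomial.eval_prod]
      rw [← e1, Polynomial.eval_eq_sum_range, tsum_eq_sum (s := Finset.range (((p n).map (algebraMap ℝ ℂ)).natDegree + 1))]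
      · simp
      · intro b hb
        simp only [Finset.mem_range, not_lt] at hb
        have := Polynomial.coeff_eq_zero_of_natDegree_lt (p := (p n).map (algebraMap ℝ ℂ)) (n := b) (by omega)
        simp only [Polynomial.coeff_map] at this
        have h2 : ((p n).coeff b : ℂ) = 0 := this
        rw [h2, zero_mul]
    simp_rw [e]
    refine tendsto_tsum_of_dominated_convergence (hsum w) (fun N => ?_) (Eventually.of_forall fun n N => ?_)
    · exact ((Complex.continuous_ofReal.tendsto _).comp (hs N)).mul_const _
    · rw [norm_mul, norm_pow, Complex.norm_real, Real.norm_of_nonneg ((hg n).1 N)]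
      gcongr; exact hb n N

lemma phaseSeq_pure {ω : ℂ} {s : ℕ → ℝ} {τ : ℝ} (hs : ∀ N, 0 ≤ s N)
    (hr : ∀ N : ℕ, ((N : ℝ) + 1) * s (N + 1) ≤ τ * s N) : PhaseSeq ω (fun N => (s N : ℂ) * ω ^ N) := by
  by_cases h : ∃ M, s M = 0
  · left
    obtain ⟨M, hM⟩ := h
    refine ⟨M, fun N hN => ?_⟩
    have : s N = 0 := by
      induction N, hN using Nat.le_induction with
      | base => exact hM
      | succ N _ ih =>
        have := hr N
        rw [ih, mul_zero] at this
        have h2 := hs (N + 1)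
        have h3 : (0 : ℝ) < N + 1 := by positivity
        nlinarith
    simp [this]
  · right
    push Not at h
    have hpos : ∀ N, 0 < s N := fun N => (hs N).lt_of_ne (h N).symm
    refine ⟨fun N => s N, 1, fun N => mul_comm _ _, Eventually.of_forall fun N => Complex.ofReal_ne_zero.2 (h N), ?_, ?_⟩
    · rw [tendsto_zero_iff_norm_tendsto_zero]
      have hl : Tendsto (fun N : ℕ => τ * (1 / ((N : ℝ) + 1))) atTop (𝓝 0) := by
        simpa using (tendsto_one_div_add_atTop_nhds_zero_nat (𝕜 := ℝ)).const_mul τ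
      refine squeeze_zero (fun _ => norm_nonneg _) (fun N => ?_) hl
      rw [norm_div, Complex.norm_real, Complex.norm_real, Real.norm_of_nonneg (hs _), Real.norm_of_nonneg (hs _)]
      have h3 : (0 : ℝ) < N + 1 := by positivity
      rw [div_le_iff₀ (hpos N), mul_one_div, div_mul_eq_mul_div, le_div_iff₀ h3]
      linarith [hr N]
    · refine tendsto_const_nhds.congr fun N => ?_
      rw [Complex.norm_real, Real.norm_of_nonneg (hs _), div_self]
      exact Complex.ofReal_ne_zero.2 (h N)

/-- Coefficients of the product with `a + b z`. -/
def linMul (a b : ℂ) (x : ℕ → ℂ) : ℕ → ℂ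
  | 0 => a * x 0
  | N + 1 => a * x (N + 1) + b * x N

lemma hasSum_linMul {a b z H : ℂ} {x : ℕ → ℂ} (h : HasSum (fun N => x N * z ^ N) H) :
    HasSum (fun N => linMul a b x N * z ^ N) ((a + b * z) * H) := by
  rw [← hasSum_nat_add_iff' 1]
  have h1 := (hasSum_nat_add_iff' 1).2 h
  have := (h1.mul_left a).add (h.mul_left (b * z))
  simp only [Finset.range_one, Finset.sum_singleton, pow_zero, mul_one] at this ⊢
  have e1 : (fun N => linMul a b x (N + 1) * z ^ (N + 1)) =
      fun N => a * (x (N + 1) * z ^ (N + 1)) + b * z * (x N * z ^ N) := by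
    funext N; simp only [linMul]; ring
  have e2 : (a + b * z) * H - linMul a b x 0 = a * (H - x 0) + b * z * H := by
    simp only [linMul]; ring
  rw [e1, e2]
  exact this

lemma PhaseSeq.linMul {ω a b : ℂ} {x : ℕ → ℂ} (hω : ω ≠ 0) (hb : b ≠ 0) (h : PhaseSeq ω x) :
    PhaseSeq ω (linMul a b x) := by
  rcases h with ⟨M, hM⟩ | ⟨y, η, hxy, hy, hr, hη⟩
  · left
    refine ⟨M + 1, fun N hN => ?_⟩
    obtain ⟨K, rfl⟩ : ∃ K, N = K + 1 := ⟨N - 1, by omega⟩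
    simp [_root_.linMul, hM K (by omega), hM (K + 1) (by omega)]
  · right
    set β : ℂ := b / ω with hβ
    have hβ0 : β ≠ 0 := div_ne_zero hb hω
    set g : ℕ → ℂ := fun N => a * (y (N + 1) / y N) + β with hg
    have hgt : Tendsto g atTop (𝓝 β) := by
      simpa using (hr.const_mul a).add_const β
    have hgne : ∀ᶠ N in atTop, g N ≠ 0 := hgt.eventually_ne hβ0
    set y' : ℕ → ℂ := fun N => _root_.linMul a b x N / ω ^ N with hy'
    have hy'e : ∀ᶠ N in atTop, y' (N + 1) = y N * g N := by
      filter_upwards [hy] with N hN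
      simp only [hy', _root_.linMul, hg, hβ, hxy]
      field_simp
      ring
    refine ⟨y', η * (β / (‖β‖ : ℂ)), fun N => ?_, ?_, ?_, ?_⟩
    · simp only [hy']; field_simp
    · obtain ⟨K, hK⟩ := eventually_atTop.1 (hy.and (hgne.and hy'e))
      filter_upwards [eventually_ge_atTop (K + 1)] with N hN
      obtain ⟨L, rfl⟩ : ∃ L, N = L + 1 := ⟨N - 1, by omega⟩
      obtain ⟨c1, c2, c3⟩ := hK L (by omega)
      rw [c3]; exact mul_ne_zero c1 c2
    · rw [← tendsto_add_atTop_iff_nat 1]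
      have : Tendsto (fun N => (y (N + 1) / y N) * (g (N + 1) / g N)) atTop (𝓝 0) := by
        simpa using hr.mul (((tendsto_add_atTop_iff_nat 1).2 hgt).div hgt hβ0)
      refine this.congr' ?_
      filter_upwards [hy'e, (tendsto_add_atTop_nat 1).eventually hy'e] with N e1 e2
      rw [e1, e2, mul_div_mul_comm]
    · rw [← tendsto_add_atTop_iff_nat 1]
      have hn : Tendsto (fun N => (‖g N‖ : ℂ)) atTop (𝓝 (‖β‖ : ℂ)) :=
        (Complex.continuous_ofReal.tendsto _).comp hgt.norm
      have := hη.mul (hgt.div hn (by simpa using hβ0))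
      refine this.congr' ?_
      filter_upwards [hy'e] with N e1
      rw [e1, norm_mul]; push_cast
      rw [mul_div_mul_comm]; rfl

/-- Entire functions with asymptotic coefficient phase. -/
def EntPhase (ω : ℂ) (h : ℂ → ℂ) : Prop :=
  (∃ x : ℕ → ℂ, (∀ z, HasSum (fun N => x N * z ^ N) (h z)) ∧ PhaseSeq ω x) ∧
    ∀ᶠ w in 𝓝[≠] (0 : ℂ), h w ≠ 0

/-- Elementary factor. -/
noncomputable def Efac (u w : ℂ) : ℂ := if u = 0 then w else 1 - w / u

lemma EntPhase.lin {ω a b : ℂ} {h : ℂ → ℂ} (hω : ω ≠ 0) (hb : b ≠ 0) (H : EntPhase ω h) :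
    EntPhase ω (fun z => (a + b * z) * h z) := by
  obtain ⟨⟨x, hx, hp⟩, hn⟩ := H
  refine ⟨⟨_, fun z => hasSum_linMul (hx z), hp.linMul hω hb⟩, ?_⟩
  have : ∀ᶠ w in 𝓝[≠] (0 : ℂ), a + b * w ≠ 0 := by
    by_cases ha : a = 0
    · filter_upwards [self_mem_nhdsWithin] with w hw
      simp [ha, hb]; exact hw
    · refine eventually_nhdsWithin_of_eventually_nhds ?_
      have hc : ContinuousAt (fun w : ℂ => a + b * w) 0 := by fun_prop
      exact hc.eventually_ne (by simpa using ha)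
  filter_upwards [this, hn] with w a b using mul_ne_zero a b

lemma EntPhase.efac {ω u : ℂ} {h : ℂ → ℂ} (hω : ω ≠ 0) (H : EntPhase ω h) :
    EntPhase ω (fun z => Efac u z * h z) := by
  by_cases hu : u = 0
  · have := H.lin hω (a := 0) (b := 1) one_ne_zero
    simpa [Efac, hu] using this
  · have := H.lin hω (a := 1) (b := -u⁻¹) (by simpa using hu)
    convert this using 3
    simp [Efac, hu]; ring

lemma EntPhase.efac_pow {ω u : ℂ} {h : ℂ → ℂ} (hω : ω ≠ 0) (H : EntPhase ω h) (k : ℕ) :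
    EntPhase ω (fun z => Efac u z ^ k * h z) := by
  induction k with
  | zero => simpa using H
  | succ k ih =>
    have := ih.efac (u := u) hω
    convert this using 2
    ring

lemma EntPhase.efac_prod {ω : ℂ} {h : ℂ → ℂ} (hω : ω ≠ 0) (H : EntPhase ω h) (m : ℂ → ℕ) (X : Finset ℂ) :
    EntPhase ω (fun z => (∏ u ∈ X, Efac u z ^ m u) * h z) := by
  classical
  induction X using Finset.induction_on with
  | empty => simpa using H
  | insert u X hu ih =>
    have := ih.efac_pow (u := u) hω (m u)
    convert this using 2
    rw [Finset.prod_insert hu, mul_assoc]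

/-- An everywhere convergent power series is entire. -/
lemma hasFPS_of_hasSum {x : ℕ → ℂ} {h : ℂ → ℂ} (hx : ∀ z, HasSum (fun N => x N * z ^ N) (h z)) :
    HasFPowerSeriesOnBall h (FormalMultilinearSeries.ofScalars ℂ x) 0 ⊤ := by
  have hn : ∀ (n : ℕ) (y : ℂ), (FormalMultilinearSeries.ofScalars ℂ x n) (fun _ => y) = x n * y ^ n := by
    intro n y; simp [mul_comm]
  refine ⟨?_, by simp, fun {y} _ => ?_⟩
  · rw [top_le_iff, FormalMultilinearSeries.radius_eq_top_iff_summable_norm]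
    intro r
    have := (hx (r : ℂ)).summable.norm
    refine this.congr fun n => ?_
    rw [FormalMultilinearSeries.ofScalars_norm]
    simp
  · simp only [hn, zero_add]
    exact hx y

lemma exists_entPhase (m : ℂ → ℕ) (S : ℕ → Finset ℂ)
    (hS : ∀ n u, u ∈ S n ↔ m u ≠ 0 ∧ ‖u‖ ≤ n) (τ : ℝ)
    (hτ : ∀ n, ∑ u ∈ S n, (m u : ℝ) * ‖u‖⁻¹ ≤ τ) (α : ℝ) (hfin : ({u | m u ≠ 0} \ Ray α).Finite) :
    ∃ h, EntPhase (-Complex.exp (-(α * Complex.I))) h ∧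
      ∀ w, Tendsto (fun n => ∏ u ∈ S n, Efac u w ^ m u) atTop (𝓝 (h w)) := by
  classical
  set ω := -Complex.exp (-(α * Complex.I)) with hω
  have hω0 : ω ≠ 0 := by simp [hω]
  set X := hfin.toFinset with hX
  obtain ⟨s, h1, hs0, hs, hr, hsum, hlim⟩ := pure_limit (fun n => S n \ X)
    (fun k l hkl u hu => by
      simp only [Finset.mem_sdiff, hS] at hu ⊢
      exact ⟨⟨hu.1.1, hu.1.2.trans (by exact_mod_cast hkl)⟩, hu.2⟩) m (fun u => ‖u‖⁻¹)
    (fun u => by positivity) τ (fun n => (Finset.sum_le_sum_of_subset_of_nonneg Finset.sdiff_subset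
      (fun _ _ _ => by positivity)).trans (hτ n))
  have hpure : EntPhase ω (fun z => h1 (ω * z)) := by
    refine ⟨⟨fun N => (s N : ℂ) * ω ^ N, fun z => ?_, phaseSeq_pure hs hr⟩, ?_⟩
    · have := hsum (ω * z)
      simpa only [mul_pow, mul_assoc] using this
    · have hA := (hasFPS_of_hasSum hsum).hasFPowerSeriesAt.continuousAt
      have h10 : h1 0 = 1 := by
        refine (hsum 0).unique ?_
        have := hasSum_single (f := fun N => (s N : ℂ) * (0 : ℂ) ^ N) 0 (by intro b hb; simp [hb])
        simpa [hs0] using this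
      have hc : ContinuousAt (fun z => h1 (ω * z)) 0 := by
        refine ContinuousAt.comp (g := h1) (by simpa using hA) (by fun_prop)
      exact eventually_nhdsWithin_of_eventually_nhds (hc.eventually_ne (by simp [h10]))
  refine ⟨fun z => (∏ u ∈ X, Efac u z ^ m u) * h1 (ω * z), hpure.efac_prod hω0 m X, fun w => ?_⟩
  refine ((hlim (ω * w)).const_mul (∏ u ∈ X, Efac u w ^ m u)).congr' ?_
  obtain ⟨K, hK⟩ : ∃ K : ℕ, ∀ u ∈ X, ‖u‖ ≤ K := by
    obtain ⟨B, hB⟩ := (X.finite_toSet.image (fun u => ‖u‖)).bddAbove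
    obtain ⟨K, hK⟩ := exists_nat_ge B
    exact ⟨K, fun u hu => (hB ⟨u, hu, rfl⟩).trans hK⟩
  filter_upwards [eventually_ge_atTop K] with n hn
  have hXS : X ⊆ S n := by
    intro u hu
    rw [hS]
    refine ⟨?_, (hK u hu).trans (by exact_mod_cast hn)⟩
    rw [hX, Finite.mem_toFinset] at hu
    exact hu.1
  rw [← Finset.prod_sdiff hXS, mul_comm]
  congr 1
  refine Finset.prod_congr rfl fun u hu => ?_
  rw [Finset.mem_sdiff, hS, hX, Finite.mem_toFinset] at hu
  have hu' : u ∈ Ray α := by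
    by_contra hc
    exact hu.2 ⟨hu.1.1, hc⟩
  obtain ⟨t, ht, rfl⟩ := hu'
  have he : Complex.exp (α * Complex.I) ≠ 0 := Complex.exp_ne_zero _
  have ht' : (t : ℂ) ≠ 0 := by exact_mod_cast ht.ne'
  have hn : ‖(t : ℂ) * Complex.exp (α * Complex.I)‖ = t := by
    rw [norm_mul, Complex.norm_exp_ofReal_mul_I, Complex.norm_real, Real.norm_of_nonneg ht.le, mul_one]
  rw [hn, Efac, if_neg (mul_ne_zero ht' he), hω, Complex.exp_neg]
  congr 1
  push_cast
  field_simp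
  ring

lemma harmonic_diff {φ : ℂ → ℝ} {R : ℝ} (hR : 0 < R)
    (hφ : InnerProductSpace.HarmonicOnNhd φ (Metric.closedBall 0 R)) {w : ℂ} (hw : ‖w‖ ≤ R / 2) :
    |φ w - φ 0| ≤ 4 * ‖w‖ / R * Real.circleAverage (fun z => |φ z|) 0 R := by
  have hwb : w ∈ Metric.ball (0 : ℂ) R := by simp; linarith
  have hab : |R| = R := abs_of_pos hR
  set K : ℂ → ℝ := Complex.re ∘ herglotzRieszKernel 0 w with hK
  have e1 : Real.circleAverage (K • φ) 0 R = φ w := hφ.circleAverage_re_herglotzRieszKernel_smul hwb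
  have e0 : Real.circleAverage φ 0 R = φ 0 :=
    InnerProductSpace.HarmonicOnNhd.circleAverage_eq (by rwa [hab])
  have cφ : ContinuousOn φ (Metric.sphere 0 R) := hφ.continuousOn.mono Metric.sphere_subset_closedBall
  have cK : ContinuousOn K (Metric.sphere 0 R) := by
    have := continuousOn_herglotzRieszKernel_sphere hwb
    rw [hab] at this
    exact Complex.continuous_re.comp_continuousOn this
  have iφ := cφ.circleIntegrable hR.le
  have iKφ := (cK.smul cφ).circleIntegrable hR.le
  have ed : φ w - φ 0 = Real.circleAverage (K • φ - φ) 0 R := by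
    rw [Real.circleAverage_sub iKφ iφ, e1, e0]
  rw [ed]
  refine Real.abs_circleAverage_le_circleAverage_abs.trans ?_
  have : Real.circleAverage (fun z => (4 * ‖w‖ / R) • |φ z|) 0 R = 4 * ‖w‖ / R * Real.circleAverage (fun z => |φ z|) 0 R := by
    rw [Real.circleAverage_fun_smul, smul_eq_mul]
  rw [← this]
  refine Real.circleAverage_mono (iKφ.sub iφ).abs ?_ fun z hz => ?_
  · exact (iφ.abs).const_smul
  · rw [hab] at hz
    have k1 : K z ≤ (R + ‖w‖) / (R - ‖w‖) := by
      have := re_herglotzRieszKernel_le hz hwb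
      simpa [hK, herglotzRieszKernel_def] using this
    have k2 : (R - ‖w‖) / (R + ‖w‖) ≤ K z := by
      have := le_re_herglotzRieszKernel hz hwb
      simpa [hK, herglotzRieszKernel_def] using this
    have hw0 := norm_nonneg w
    have hk : |K z - 1| ≤ 4 * ‖w‖ / R := by
      rw [abs_le]
      constructor
      · have : 1 - 4 * ‖w‖ / R ≤ (R - ‖w‖) / (R + ‖w‖) := by
          rw [le_div_iff₀ (by linarith)]
          have : (1 - 4 * ‖w‖ / R) * (R + ‖w‖) = R - ‖w‖ - (2 * ‖w‖ + 4 * ‖w‖ ^ 2 / R) := by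
            field_simp; ring
          rw [this]
          have : 0 ≤ 2 * ‖w‖ + 4 * ‖w‖ ^ 2 / R := by positivity
          linarith
        linarith
      · have : (R + ‖w‖) / (R - ‖w‖) ≤ 1 + 4 * ‖w‖ / R := by
          rw [div_le_iff₀ (by linarith)]
          have e : (1 + 4 * ‖w‖ / R) * (R - ‖w‖) = R + ‖w‖ + (2 * ‖w‖ / R) * (R - 2 * ‖w‖) := by
            field_simp; ring
          rw [e]
          have : 0 ≤ (2 * ‖w‖ / R) * (R - 2 * ‖w‖) := mul_nonneg (by positivity) (by linarith)
          linarith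
        linarith
    have : (K • φ - φ) z = (K z - 1) * φ z := by simp; ring
    show |(K • φ - φ) z| ≤ (4 * ‖w‖ / R) • |φ z|
    rw [this, abs_mul, smul_eq_mul]
    gcongr

lemma log_efac {u w : ℂ} (h : w ≠ u) : Real.log ‖w - u‖ = Real.log ‖Efac u w‖ + Real.log ‖u‖ := by
  by_cases hu : u = 0
  · simp [Efac, hu]
  · rw [Efac, if_neg hu, ← Real.log_mul, ← norm_mul, norm_sub_rev]
    · congr 2; field_simp
    · rw [norm_ne_zero_iff, sub_ne_zero]; intro h2; apply h; field_simp at h2; exact h2.symm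
    · simpa using hu

lemma decomp_bound {F : ℂ → ℂ} (hF : MeromorphicOn F Set.univ) (hord : ∀ u, meromorphicOrderAt F u ≠ ⊤)
    {R : ℝ} (hR : 1 ≤ R) (T : Finset ℂ)
    (hT : ∀ u, u ∈ T ↔ MeromorphicOn.divisor F Set.univ u ≠ 0 ∧ ‖u‖ ≤ R) :
    ∃ L : ℝ, ∀ w, ‖w‖ ≤ R / 2 → AnalyticAt ℂ F w → F w ≠ 0 →
      |Real.log ‖F w‖ - ∑ u ∈ T, (MeromorphicOn.divisor F Set.univ u : ℝ) * Real.log ‖Efac u w‖ - L|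
        ≤ 4 * ‖w‖ / R * (Real.circleAverage (fun z => |Real.log ‖F z‖|) 0 R
            + Real.log 2 * ∑ u ∈ T, |(MeromorphicOn.divisor F Set.univ u : ℝ)|) := by
  have hR0 : 0 < R := by linarith
  have hab : |R| = R := abs_of_pos hR0
  set D := MeromorphicOn.divisor F Set.univ with hD
  set U := Metric.closedBall (0 : ℂ) R with hU
  have hFU : MeromorphicOn F U := hF.mono_set (subset_univ _)
  have hDU : ∀ u ∈ U, MeromorphicOn.divisor F U u = D u := by
    intro u hu
    rw [hD, MeromorphicOn.divisor_apply hFU hu, MeromorphicOn.divisor_apply hF (mem_univ u)]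
  have hDU' : ∀ u ∉ U, MeromorphicOn.divisor F U u = 0 := fun u hu =>
    (MeromorphicOn.divisor F U).apply_eq_zero_of_notMem hu
  obtain ⟨g, g1, g2, g3⟩ := hFU.extract_zeros_poles (fun u => hord u)
    ((MeromorphicOn.divisor F U).finiteSupport (isCompact_closedBall 0 R))
  have g4 := MeromorphicOn.extract_zeros_poles_log g2 g3
  have esum : (∑ᶠ u, (fun z : ℂ => (MeromorphicOn.divisor F U u : ℝ) * Real.log ‖z - u‖))
      = fun z => ∑ u ∈ T, (D u : ℝ) * Real.log ‖z - u‖ := by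
    rw [finsum_eq_sum_of_support_subset (s := T)]
    · funext z
      rw [Finset.sum_apply]
      refine Finset.sum_congr rfl fun u hu => ?_
      rw [hDU u (by simpa [hU] using ((hT u).1 hu).2)]
    · intro u hu
      by_contra hc
      apply hu
      have : MeromorphicOn.divisor F U u = 0 := by
        by_cases h : u ∈ U
        · rw [hDU u h]
          by_contra h3
          exact hc ((hT u).2 ⟨h3, by simpa [hU] using h⟩)
        · exact hDU' u h
      funext z; simp [this]
  rw [esum] at g4
  set κ : ℝ := ∑ u ∈ T, (D u : ℝ) * Real.log (2 * R) with hκ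
  set φ : ℂ → ℝ := fun z => Real.log ‖(Real.exp κ : ℂ) * g z‖ with hφ
  have hφe : ∀ z ∈ U, φ z = κ + Real.log ‖g z‖ := by
    intro z hz
    simp only [hφ]
    rw [norm_mul, Real.log_mul (by simp) (by simpa using g2 ⟨z, hz⟩), Complex.norm_real,
      Real.norm_of_nonneg (Real.exp_pos _).le, Real.log_exp]
  have hharm : InnerProductSpace.HarmonicOnNhd φ (Metric.closedBall 0 R) := by
    intro z hz
    exact (analyticAt_const.mul (g1 z hz)).harmonicAt_log_norm
      (mul_ne_zero (Complex.ofReal_ne_zero.2 (Real.exp_pos κ).ne') (g2 ⟨z, hz⟩))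
  have hlogle : ∀ u ∈ T, ∀ z ∈ Metric.sphere (0 : ℂ) R, Real.log ‖z - u‖ ≤ Real.log (2 * R) := by
    intro u hu z hz
    rcases (norm_nonneg (z - u)).eq_or_lt with h | h
    · rw [← h, Real.log_zero]; exact Real.log_nonneg (by linarith)
    · refine Real.log_le_log h ((norm_sub_le _ _).trans ?_)
      have := ((hT u).1 hu).2
      have : ‖z‖ = R := by simpa using hz
      linarith
  have iF : CircleIntegrable (fun z => Real.log ‖F z‖) 0 R :=
    MeromorphicOn.circleIntegrable_log_norm (hF.mono_set (subset_univ _))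
  have iu : ∀ u : ℂ, CircleIntegrable (fun z => Real.log ‖z - u‖) 0 R := fun u =>
    MeromorphicOn.circleIntegrable_log_norm (f := fun z => z - u)
      ((analyticOnNhd_id.sub analyticOnNhd_const).meromorphicOn)
  have iu2 : ∀ u : ℂ, CircleIntegrable (fun z => |(D u : ℝ)| * (Real.log (2 * R) - Real.log ‖z - u‖)) 0 R := fun u =>
    ((circleIntegrable_const _ _ _).sub (iu u)).const_smul (a := |(D u : ℝ)|)
  have iS : CircleIntegrable (fun z => ∑ u ∈ T, |(D u : ℝ)| * (Real.log (2 * R) - Real.log ‖z - u‖)) 0 R := by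
    have := CircleIntegrable.sum T (f := fun u z => |(D u : ℝ)| * (Real.log (2 * R) - Real.log ‖z - u‖))
      (fun u _ => iu2 u)
    convert this using 1
    funext z; simp
  have iS' : CircleIntegrable (fun z => ∑ u ∈ T, (D u : ℝ) * (Real.log ‖z - u‖ - Real.log (2 * R))) 0 R := by
    have := CircleIntegrable.sum T (f := fun u z => (D u : ℝ) * (Real.log ‖z - u‖ - Real.log (2 * R)))
      (fun u _ => ((iu u).sub (circleIntegrable_const _ _ _)).const_smul (a := (D u : ℝ)))
    convert this using 1
    funext z; simp
  have havg : Real.circleAverage (fun z => |φ z|) 0 R ≤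
      Real.circleAverage (fun z => |Real.log ‖F z‖|) 0 R + Real.log 2 * ∑ u ∈ T, |(D u : ℝ)| := by
    have c1 : Real.circleAverage (fun z => |φ z|) 0 R = Real.circleAverage (fun z => |Real.log ‖F z‖
        - ∑ u ∈ T, (D u : ℝ) * (Real.log ‖z - u‖ - Real.log (2 * R))|) 0 R := by
      refine Real.circleAverage_congr_codiscreteWithin ?_ hR0.ne'
      rw [hab]
      have g5 := codiscreteWithin_mono (Metric.sphere_subset_closedBall) g4
      filter_upwards [g5, self_mem_codiscreteWithin _] with z hz hzU
      have hzU' : z ∈ U := Metric.sphere_subset_closedBall hzU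
      simp only [hz, hφe z hzU', Pi.add_apply, mul_sub, Finset.sum_sub_distrib, ← hκ]
      congr 1; ring
    rw [c1]
    have c2 : Real.circleAverage (fun z => ∑ u ∈ T, |(D u : ℝ)| * (Real.log (2 * R) - Real.log ‖z - u‖)) 0 R
        = Real.log 2 * ∑ u ∈ T, |(D u : ℝ)| := by
      rw [Real.circleAverage_fun_sum (fun u _ => iu2 u), Finset.mul_sum]
      refine Finset.sum_congr rfl fun u hu => ?_
      have := Real.circleAverage_fun_smul (a := |(D u : ℝ)|) (c := (0 : ℂ)) (R := R)
        (f := fun z => Real.log (2 * R) - Real.log ‖z - u‖)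
      simp only [smul_eq_mul] at this
      rw [this, Real.circleAverage_fun_sub (circleIntegrable_const _ _ _) (iu u), Real.circleAverage_const,
        circleAverage_log_norm_sub_const_of_mem_closedBall (by simpa [hab] using ((hT u).1 hu).2),
        Real.log_mul (by norm_num) hR0.ne']
      ring
    have iFa : CircleIntegrable (fun z => |Real.log ‖F z‖|) 0 R := iF.abs
    rw [← c2, ← Real.circleAverage_fun_add iFa iS]
    refine Real.circleAverage_mono (iF.sub iS').abs (iF.abs.add iS) fun z hz => ?_
    rw [hab] at hz
    refine (abs_sub _ _).trans ?_
    refine add_le_add le_rfl ((Finset.abs_sum_le_sum_abs _ _).trans (Finset.sum_le_sum fun u hu => ?_))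
    rw [abs_mul, abs_sub_comm, abs_of_nonneg (sub_nonneg.2 (hlogle u hu z hz))]
  refine ⟨∑ u ∈ T, (D u : ℝ) * Real.log ‖u‖ + Real.log ‖g 0‖, fun w hw hFw hFw0 => ?_⟩
  have hwU : w ∈ U := by simp [hU]; linarith
  have hDw : D w = 0 := by
    rw [hD, MeromorphicOn.divisor_apply hF (mem_univ w)]
    have : meromorphicOrderAt F w = 0 := by
      rw [hFw.meromorphicOrderAt_eq, hFw.analyticOrderAt_eq_zero.2 hFw0]; rfl
    simp [this]
  have hwT : ∀ u ∈ T, w ≠ u := by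
    rintro u hu rfl
    exact ((hT w).1 hu).1 hDw
  have hval : Real.log ‖F w‖ = ∑ u ∈ T, (D u : ℝ) * Real.log ‖w - u‖ + Real.log ‖g w‖ := by
    have ev : ∀ᶠ z in 𝓝[≠] w, Real.log ‖F z‖ = ∑ u ∈ T, (D u : ℝ) * Real.log ‖z - u‖ + Real.log ‖g z‖ := by
      have h5 := (mem_codiscreteWithin_iff_forall_mem_nhdsNE.1 g4) w hwU
      have hUn : U ∈ 𝓝[≠] w := nhdsWithin_le_nhds (Metric.closedBall_mem_nhds_of_mem (by simp; linarith))
      filter_upwards [h5, hUn] with z hz hzU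
      rcases hz with hz | hz
      · exact hz
      · exact absurd hzU hz
    have cl : ContinuousAt (fun z => Real.log ‖F z‖) w :=
      hFw.continuousAt.norm.log (by simpa using hFw0)
    have cr : ContinuousAt (fun z => ∑ u ∈ T, (D u : ℝ) * Real.log ‖z - u‖ + Real.log ‖g z‖) w := by
      refine ContinuousAt.add ?_ ((g1 w hwU).continuousAt.norm.log (by simpa using g2 ⟨w, hwU⟩))
      refine tendsto_finsetSum _ fun u hu => ?_
      refine tendsto_const_nhds.mul ?_
      have : ContinuousAt (fun z : ℂ => Real.log ‖z - u‖) w :=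
        ContinuousAt.log (by fun_prop) (by simpa [sub_eq_zero] using hwT u hu)
      exact this
    refine tendsto_nhds_unique (f := fun z => Real.log ‖F z‖) (l := 𝓝[≠] w) (cl.tendsto.mono_left nhdsWithin_le_nhds) ?_
    exact (cr.tendsto.mono_left nhdsWithin_le_nhds).congr' (ev.mono fun z hz => hz.symm)
  have key : Real.log ‖F w‖ - ∑ u ∈ T, (D u : ℝ) * Real.log ‖Efac u w‖ -
      (∑ u ∈ T, (D u : ℝ) * Real.log ‖u‖ + Real.log ‖g 0‖) = φ w - φ 0 := by
    rw [hval, hφe w hwU, hφe 0 (by simp [hU]; linarith)]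
    have : ∑ u ∈ T, (D u : ℝ) * Real.log ‖w - u‖ = ∑ u ∈ T, (D u : ℝ) * Real.log ‖Efac u w‖
        + ∑ u ∈ T, (D u : ℝ) * Real.log ‖u‖ := by
      rw [← Finset.sum_add_distrib]
      refine Finset.sum_congr rfl fun u hu => ?_
      rw [log_efac (hwT u hu)]; ring
    rw [this]; ring
  rw [key]
  refine (harmonic_diff hR0 hharm hw).trans ?_
  gcongr

lemma summab_of_count (m : ℂ → ℕ) (S : ℕ → Finset ℂ) (hS : ∀ n u, u ∈ S n ↔ m u ≠ 0 ∧ ‖u‖ ≤ n)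
    {C ρ R0 : ℝ} (hC : 0 ≤ C) (hρ : ρ < 1)
    (hcount : ∀ r, R0 ≤ r → ∀ T : Finset ℂ, (∀ u ∈ T, ‖u‖ ≤ r) → ∑ u ∈ T, (m u : ℝ) ≤ C * r ^ ρ) :
    ∃ τ, ∀ n, ∑ u ∈ S n, (m u : ℝ) * ‖u‖⁻¹ ≤ τ := by
  classical
  obtain ⟨n1, hn1⟩ := exists_nat_ge (max R0 1)
  have hR0 : R0 ≤ n1 := (le_max_left _ _).trans hn1
  have h1 : (1 : ℝ) ≤ n1 := (le_max_right _ _).trans hn1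
  set q : ℝ := (2 : ℝ) ^ (ρ - 1) with hq
  have hq0 : 0 < q := by positivity
  have hq1 : q < 1 := Real.rpow_lt_one_of_one_lt_of_neg (by norm_num) (by linarith)
  refine ⟨∑ u ∈ S n1, (m u : ℝ) * ‖u‖⁻¹ + 2 * C * (1 - q)⁻¹, fun n => ?_⟩
  rw [← Finset.sum_filter_add_sum_filter_not (S n) (fun u => ‖u‖ ≤ n1)]
  refine add_le_add ?_ ?_
  · refine Finset.sum_le_sum_of_subset_of_nonneg ?_ fun u _ _ => by positivity
    intro u hu
    rw [Finset.mem_filter, hS] at hu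
    rw [hS]; exact ⟨hu.1.1, hu.2⟩
  · set V := (S n).filter (fun u => ¬ ‖u‖ ≤ n1) with hV
    have hk : ∀ u : ℂ, ∃ k : ℕ, ‖u‖ ≤ 2 ^ k := fun u => by
      obtain ⟨k, hk⟩ := pow_unbounded_of_one_lt ‖u‖ (by norm_num : (1:ℝ) < 2)
      exact ⟨k, hk.le⟩
    set kk : ℂ → ℕ := fun u => Nat.find (hk u) with hkk
    have hk1 : ∀ u, ‖u‖ ≤ 2 ^ kk u := fun u => Nat.find_spec (hk u)
    have hk2 : ∀ u ∈ V, ‖u‖⁻¹ ≤ 2 * (2 ^ kk u)⁻¹ := by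
      intro u hu
      have hun : (n1:ℝ) < ‖u‖ := by simpa using (Finset.mem_filter.1 hu).2
      have hpos : kk u ≠ 0 := by
        intro h0
        have := hk1 u
        rw [h0] at this
        simp at this; linarith
      obtain ⟨j, hj⟩ := Nat.exists_eq_succ_of_ne_zero hpos
      have : ¬ ‖u‖ ≤ 2 ^ j := Nat.find_min (hk u) (show j < kk u by omega)
      rw [hj, pow_succ, mul_inv, mul_comm, mul_assoc, inv_mul_cancel₀ (by norm_num), mul_one]
      exact inv_anti₀ (by positivity) (not_le.1 this).le
    set M := V.sup kk + 1 with hM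
    have hkM : ∀ u ∈ V, kk u ∈ Finset.range M := fun u hu => by
      rw [Finset.mem_range]; exact Nat.lt_succ_of_le (Finset.le_sup hu)
    calc ∑ u ∈ V, (m u : ℝ) * ‖u‖⁻¹ = ∑ k ∈ Finset.range M, ∑ u ∈ V.filter (fun u => kk u = k), (m u : ℝ) * ‖u‖⁻¹ :=
          (Finset.sum_fiberwise_of_maps_to hkM _).symm
      _ ≤ ∑ k ∈ Finset.range M, 2 * C * q ^ k := by
          refine Finset.sum_le_sum fun k _ => ?_
          rcases (V.filter (fun u => kk u = k)).eq_empty_or_nonempty with he | ⟨u0, hu0⟩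
          · rw [he, Finset.sum_empty]; positivity
          · have hb : R0 ≤ (2:ℝ) ^ k := by
              rw [Finset.mem_filter] at hu0
              have hun : (n1:ℝ) < ‖u0‖ := by simpa using (Finset.mem_filter.1 hu0.1).2
              have := hk1 u0
              rw [hu0.2] at this
              linarith
            calc ∑ u ∈ V.filter (fun u => kk u = k), (m u : ℝ) * ‖u‖⁻¹
                ≤ ∑ u ∈ V.filter (fun u => kk u = k), (m u : ℝ) * (2 * (2 ^ k)⁻¹) := by
                  refine Finset.sum_le_sum fun u hu => ?_
                  rw [Finset.mem_filter] at hu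
                  have := hk2 u hu.1
                  rw [hu.2] at this
                  gcongr
              _ = (∑ u ∈ V.filter (fun u => kk u = k), (m u : ℝ)) * (2 * (2 ^ k)⁻¹) := by
                  rw [Finset.sum_mul]
              _ ≤ (C * ((2:ℝ) ^ k) ^ ρ) * (2 * (2 ^ k)⁻¹) := by
                  refine mul_le_mul_of_nonneg_right (hcount _ hb _ fun u hu => ?_) (by positivity)
                  rw [Finset.mem_filter] at hu
                  rw [← hu.2]; exact hk1 u
              _ = 2 * C * q ^ k := by
                  have : q ^ k = ((2:ℝ) ^ k) ^ ρ * (2 ^ k)⁻¹ := by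
                    rw [hq, ← Real.rpow_natCast, ← Real.rpow_mul (by norm_num), ← Real.rpow_natCast,
                      ← Real.rpow_mul (by norm_num), ← Real.rpow_neg (by norm_num), ← Real.rpow_add (by norm_num)]
                    congr 1; ring
                  rw [this]; ring
      _ = 2 * C * ∑ k ∈ Finset.range M, q ^ k := by rw [Finset.mul_sum]
      _ ≤ 2 * C * (1 - q)⁻¹ := by
          refine mul_le_mul_of_nonneg_left ?_ (by positivity)
          rw [← tsum_geometric_of_lt_one hq0.le hq1]
          exact (summable_geometric_of_lt_one hq0.le hq1).sum_le_tsum _ fun i _ => by positivity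

lemma count_le_logCounting (E : Function.locallyFinsuppWithin (Set.univ : Set ℂ) ℤ) (hE : 0 ≤ E)
    {r : ℝ} (hr : 1 ≤ r) (T : Finset ℂ) (hT : ∀ u ∈ T, ‖u‖ ≤ r) :
    Real.log 2 * ∑ u ∈ T, (E u : ℝ) ≤ Function.locallyFinsuppWithin.logCounting E (2 * r) := by
  classical
  have hle : ∑ u ∈ T, Function.locallyFinsuppWithin.single u (E u) ≤ E := by
    intro z
    have : (∑ u ∈ T, Function.locallyFinsuppWithin.single u (E u)) z
        = ∑ u ∈ T, (Function.locallyFinsuppWithin.single u (E u)) z := by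
      simp [Function.locallyFinsuppWithin.coe_sum]
    rw [this]
    simp only [Function.locallyFinsuppWithin.single_apply]
    rw [Finset.sum_ite_eq]
    split_ifs
    · exact le_rfl
    · exact hE z
  have h2 := Function.locallyFinsuppWithin.logCounting_le hle (by linarith : 1 ≤ 2 * r)
  refine le_trans ?_ h2
  rw [map_sum, Finset.sum_apply, Finset.mul_sum]
  refine Finset.sum_le_sum fun u hu => ?_
  have hu' := hT u hu
  rw [Function.locallyFinsuppWithin.logCounting_single_eq_log_sub_const (by linarith), mul_comm]
  have hEu : (0:ℝ) ≤ E u := by exact_mod_cast hE u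
  refine mul_le_mul_of_nonneg_left ?_ hEu
  rw [Real.log_mul (by norm_num) (by linarith)]
  have : Real.log ‖u‖ ≤ Real.log r := by
    rcases (norm_nonneg u).eq_or_lt with h | h
    · rw [← h, Real.log_zero]; exact Real.log_nonneg hr
    · exact Real.log_le_log h hu'
  linarith

lemma exists_finsets (E : Function.locallyFinsuppWithin (Set.univ : Set ℂ) ℤ) :
    ∃ S : ℕ → Finset ℂ, ∀ n u, u ∈ S n ↔ E u ≠ 0 ∧ ‖u‖ ≤ n := by
  have hfin : ∀ n : ℕ, {u | E u ≠ 0 ∧ ‖u‖ ≤ n}.Finite := by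
    intro n
    refine ((Function.locallyFinsuppWithin.toClosedBall (n : ℝ) E).finiteSupport
      (isCompact_closedBall 0 _)).subset ?_
    intro u hu
    rw [Function.mem_support, Function.locallyFinsuppWithin.toClosedBall_eval_within]
    · exact hu.1
    · simpa using hu.2
  exact ⟨fun n => (hfin n).toFinset, fun n u => by simp⟩

lemma exists_ent (E : Function.locallyFinsuppWithin (Set.univ : Set ℂ) ℤ) (hE : 0 ≤ E)
    {K ρ R0 : ℝ} (hK : 0 ≤ K) (hρ : ρ < 1) (hR0 : 1 ≤ R0)
    (hg : ∀ r, R0 ≤ r → Function.locallyFinsuppWithin.logCounting E r ≤ K * r ^ ρ)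
    (α : ℝ) (hfin : ({u | E u ≠ 0} \ Ray α).Finite)
    (S : ℕ → Finset ℂ) (hS : ∀ n u, u ∈ S n ↔ E u ≠ 0 ∧ ‖u‖ ≤ n) :
    ∃ h, EntPhase (-Complex.exp (-(α * Complex.I))) h ∧
      ∀ w, Tendsto (fun n => ∏ u ∈ S n, Efac u w ^ (E u).toNat) atTop (𝓝 (h w)) := by
  have hm : ∀ u, ((E u).toNat : ℤ) = E u := fun u => Int.toNat_of_nonneg (hE u)
  have hm0 : ∀ u, (E u).toNat ≠ 0 ↔ E u ≠ 0 := fun u => by have := hm u; omega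
  have hS' : ∀ n u, u ∈ S n ↔ (E u).toNat ≠ 0 ∧ ‖u‖ ≤ n := fun n u => by rw [hS, hm0]
  have hl2 : 0 < Real.log 2 := Real.log_pos (by norm_num)
  obtain ⟨τ, hτ⟩ := summab_of_count (fun u => (E u).toNat) S hS' (C := K * 2 ^ ρ / Real.log 2) (ρ := ρ)
    (R0 := R0) (by positivity) hρ (by
      intro r hr T hT
      have h1 := count_le_logCounting E hE (hR0.trans hr) T hT
      have h2 := hg (2 * r) (by linarith)
      have e : ∑ u ∈ T, ((E u).toNat : ℝ) = ∑ u ∈ T, (E u : ℝ) :=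
        Finset.sum_congr rfl fun u _ => by exact_mod_cast hm u
      rw [e, div_mul_eq_mul_div, le_div_iff₀ hl2, mul_comm]
      rw [Real.mul_rpow (by norm_num) (by linarith)] at h2
      linarith)
  refine exists_entPhase (fun u => (E u).toNat) S hS' τ hτ α ?_
  simpa only [hm0] using hfin

lemma circleAverage_abs_log {F : ℂ → ℂ} (hF : Meromorphic F) (R : ℝ) :
    Real.circleAverage (fun z => |Real.log ‖F z‖|) 0 R =
      ValueDistribution.proximity F ⊤ R + ValueDistribution.proximity F⁻¹ ⊤ R := by
  rw [ValueDistribution.proximity_top, ValueDistribution.proximity_top, ← Real.circleAverage_fun_add]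
  · congr 1
    funext z
    simp only [Pi.inv_apply, norm_inv, Real.posLog_apply, Real.log_inv]
    rcases le_total 0 (Real.log ‖F z‖) with h | h
    · rw [abs_of_nonneg h, max_eq_right h, max_eq_left (by linarith)]; ring
    · rw [abs_of_nonpos h, max_eq_left h, max_eq_right (by linarith)]; ring
  · exact (hF.meromorphicOn (s := Metric.sphere 0 |R|)).circleIntegrable_posLog_norm
  · exact (hF.inv.meromorphicOn (s := Metric.sphere 0 |R|)).circleIntegrable_posLog_norm

lemma factor_ball {F : ℂ → ℂ} (hF : Meromorphic F) (hord : ∀ u, meromorphicOrderAt F u ≠ ⊤)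
    {K ρ R0 : ℝ} (hK : 0 ≤ K) (hρ : ρ < 1) (hR0 : 1 ≤ R0)
    (hg : ∀ r, R0 ≤ r → ValueDistribution.characteristic F ⊤ r ≤ K * r ^ ρ)
    (hg' : ∀ r, R0 ≤ r → ValueDistribution.characteristic F⁻¹ ⊤ r ≤ K * r ^ ρ)
    (S0 S2 : ℕ → Finset ℂ)
    (hS0 : ∀ n u, u ∈ S0 n ↔ (MeromorphicOn.divisor F Set.univ)⁺ u ≠ 0 ∧ ‖u‖ ≤ n)
    (hS2 : ∀ n u, u ∈ S2 n ↔ (MeromorphicOn.divisor F Set.univ)⁻ u ≠ 0 ∧ ‖u‖ ≤ n)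
    {h0 h2 : ℂ → ℂ}
    (t0 : ∀ w, Tendsto (fun n => ∏ u ∈ S0 n, Efac u w ^ ((MeromorphicOn.divisor F Set.univ)⁺ u).toNat) atTop (𝓝 (h0 w)))
    (t2 : ∀ w, Tendsto (fun n => ∏ u ∈ S2 n, Efac u w ^ ((MeromorphicOn.divisor F Set.univ)⁻ u).toNat) atTop (𝓝 (h2 w)))
    (d0 : Differentiable ℂ h0) (d2 : Differentiable ℂ h2)
    {w0 : ℂ} {ε : ℝ} (hε : 0 < ε) (hFa : ∀ w ∈ Metric.ball w0 ε, AnalyticAt ℂ F w)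
    (hFn : ∀ w ∈ Metric.ball w0 ε, F w ≠ 0)
    (hn0 : ∀ w ∈ Metric.ball w0 ε, h0 w ≠ 0) (hn2 : ∀ w ∈ Metric.ball w0 ε, h2 w ≠ 0) :
    ∃ c, c ≠ 0 ∧ ∀ w ∈ Metric.ball w0 ε, F w * h2 w = c * h0 w := by
  classical
  set D := MeromorphicOn.divisor F Set.univ with hD
  have hFO : MeromorphicOn F univ := hF.meromorphicOn
  have hl2 : 0 < Real.log 2 := Real.log_pos (by norm_num)
  have hDpm : ∀ u, ((D⁺ u : ℤ) : ℝ) - (D⁻ u : ℤ) = D u := fun u => by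
    have : D⁺ u - D⁻ u = D u := by
      rw [Function.locallyFinsuppWithin.posPart_apply, Function.locallyFinsuppWithin.negPart_apply]
      exact posPart_sub_negPart _
    exact_mod_cast this
  have hDab : ∀ u, |(D u : ℝ)| = ((D⁺ u : ℤ) : ℝ) + (D⁻ u : ℤ) := fun u => by
    have : |D u| = D⁺ u + D⁻ u := by
      rw [Function.locallyFinsuppWithin.posPart_apply, Function.locallyFinsuppWithin.negPart_apply]
      exact (posPart_add_negPart _).symm
    exact_mod_cast this
  have hp0 : ∀ u, 0 ≤ D⁺ u := fun u => posPart_nonneg (D u)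
  have hq0 : ∀ u, 0 ≤ D⁻ u := fun u => negPart_nonneg (D u)
  set T : ℕ → Finset ℂ := fun n => S0 n ∪ S2 n with hTdef
  have hT : ∀ n u, u ∈ T n ↔ D u ≠ 0 ∧ ‖u‖ ≤ n := by
    intro n u
    rw [hTdef, Finset.mem_union, hS0, hS2, ← or_and_right]
    refine and_congr_left fun _ => ?_
    have e1 := hDpm u
    have e2 := hDab u
    constructor
    · intro h h3
      rw [h3] at e1 e2
      simp only [Int.cast_zero, abs_zero] at e1 e2
      have a1 : ((D⁺ u : ℤ) : ℝ) = 0 := by linarith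
      have a2 : ((D⁻ u : ℤ) : ℝ) = 0 := by linarith
      rcases h with h | h
      · exact h (by exact_mod_cast a1)
      · exact h (by exact_mod_cast a2)
    · intro h
      by_contra h3
      push Not at h3
      rw [h3.1, h3.2] at e1
      apply h
      have : (D u : ℝ) = 0 := by rw [← e1]; simp
      exact_mod_cast this
  -- the key limit
  have hlim : ∃ L : ℕ → ℝ, ∀ w ∈ Metric.ball w0 ε,
      Tendsto (fun n => Real.log ‖F w‖ - ∑ u ∈ T n, (D u : ℝ) * Real.log ‖Efac u w‖ - L n) atTop (𝓝 0) := by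
    have hex : ∀ n : ℕ, ∃ L : ℝ, 1 ≤ n → ∀ w, ‖w‖ ≤ (n:ℝ) / 2 → AnalyticAt ℂ F w → F w ≠ 0 →
      |Real.log ‖F w‖ - ∑ u ∈ T n, (D u : ℝ) * Real.log ‖Efac u w‖ - L|
        ≤ 4 * ‖w‖ / n * (Real.circleAverage (fun z => |Real.log ‖F z‖|) 0 n
            + Real.log 2 * ∑ u ∈ T n, |(D u : ℝ)|) := by
      intro n
      by_cases h1 : 1 ≤ n
      · obtain ⟨L, hL⟩ := decomp_bound hFO hord (R := n) (by exact_mod_cast h1) (T n) (hT n)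
        exact ⟨L, fun _ => hL⟩
      · exact ⟨0, fun h => absurd h h1⟩
    choose L hL using hex
    refine ⟨L, fun w hw => ?_⟩
    have hbound : ∀ n : ℕ, R0 ≤ n → 2 * ‖w‖ ≤ n → 
        ‖Real.log ‖F w‖ - ∑ u ∈ T n, (D u : ℝ) * Real.log ‖Efac u w‖ - L n‖ ≤
          4 * ‖w‖ * (2 * K + 2 * K * 2 ^ ρ) * (n:ℝ) ^ (-(1 - ρ)) := by
      intro n hn hwn
      have hn1 : (1:ℝ) ≤ n := hR0.trans hn
      have hn0 : (0:ℝ) < n := by linarith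
      have b := hL n (by exact_mod_cast hn1) w (by linarith) (hFa w hw) (hFn w hw)
      rw [Real.norm_eq_abs]
      refine b.trans ?_
      have c1 : Real.circleAverage (fun z => |Real.log ‖F z‖|) 0 n ≤ 2 * K * (n:ℝ) ^ ρ := by
        rw [circleAverage_abs_log hF]
        have a1 := hg n hn
        have a2 := hg' n hn
        have a3 : 0 ≤ ValueDistribution.logCounting F ⊤ n := ValueDistribution.logCounting_nonneg hn1
        have a4 : 0 ≤ ValueDistribution.logCounting F⁻¹ ⊤ n := ValueDistribution.logCounting_nonneg hn1
        simp only [ValueDistribution.characteristic, Pi.add_apply] at a1 a2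
        linarith
      have c2 : Real.log 2 * ∑ u ∈ T n, |(D u : ℝ)| ≤ 2 * K * 2 ^ ρ * (n:ℝ) ^ ρ := by
        have hTn : ∀ u ∈ T n, ‖u‖ ≤ (n:ℝ) := fun u hu => ((hT n u).1 hu).2
        have k1 := count_le_logCounting D⁺ hp0 hn1 (T n) hTn
        have k2 := count_le_logCounting D⁻ hq0 hn1 (T n) hTn
        have a1 := hg (2 * n) (by linarith)
        have a2 := hg' (2 * n) (by linarith)
        have a3 : 0 ≤ ValueDistribution.proximity F ⊤ (2 * n) := ValueDistribution.proximity_nonneg _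
        have a4 : 0 ≤ ValueDistribution.proximity F⁻¹ ⊤ (2 * n) := ValueDistribution.proximity_nonneg _
        simp only [ValueDistribution.characteristic, Pi.add_apply] at a1 a2
        rw [ValueDistribution.logCounting_inv, ValueDistribution.logCounting_zero, ← hD] at a2
        rw [ValueDistribution.logCounting_top, ← hD] at a1
        rw [Real.mul_rpow (by norm_num) hn0.le] at a1 a2
        rw [Finset.sum_congr rfl fun u _ => hDab u, Finset.sum_add_distrib, mul_add]
        linarith
      have c3 : (n:ℝ) ^ (-(1 - ρ)) = (n:ℝ) ^ ρ / n := by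
        rw [show -(1 - ρ) = ρ - 1 by ring, Real.rpow_sub_one hn0.ne']
      rw [c3]
      calc 4 * ‖w‖ / n * (Real.circleAverage (fun z => |Real.log ‖F z‖|) 0 n
            + Real.log 2 * ∑ u ∈ T n, |(D u : ℝ)|)
          ≤ 4 * ‖w‖ / n * (2 * K * (n:ℝ) ^ ρ + 2 * K * 2 ^ ρ * (n:ℝ) ^ ρ) := by gcongr
        _ = _ := by ring
    have hz : Tendsto (fun n : ℕ => 4 * ‖w‖ * (2 * K + 2 * K * 2 ^ ρ) * (n:ℝ) ^ (-(1 - ρ))) atTop (𝓝 0) := by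
      have := ((tendsto_rpow_neg_atTop (by linarith : 0 < 1 - ρ)).comp
        tendsto_natCast_atTop_atTop).const_mul (4 * ‖w‖ * (2 * K + 2 * K * 2 ^ ρ))
      simpa using this
    refine squeeze_zero_norm' ?_ hz
    filter_upwards [tendsto_natCast_atTop_atTop.eventually_ge_atTop R0,
      tendsto_natCast_atTop_atTop.eventually_ge_atTop (2 * ‖w‖)] with n a1 a2
    exact hbound n a1 a2
  obtain ⟨L, hL⟩ := hlim
  have hlogs : ∀ w ∈ Metric.ball w0 ε, ∀ n, ∑ u ∈ T n, (D u : ℝ) * Real.log ‖Efac u w‖ =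
      Real.log ‖∏ u ∈ S0 n, Efac u w ^ (D⁺ u).toNat‖ - Real.log ‖∏ u ∈ S2 n, Efac u w ^ (D⁻ u).toNat‖ := by
    intro w hw n
    have hDw : D w = 0 := by
      rw [hD, MeromorphicOn.divisor_apply hFO (mem_univ w)]
      have : meromorphicOrderAt F w = 0 := by
        rw [(hFa w hw).meromorphicOrderAt_eq, (hFa w hw).analyticOrderAt_eq_zero.2 (hFn w hw)]; rfl
      simp [this]
    have hef : ∀ u, D u ≠ 0 → Efac u w ≠ 0 := by
      intro u hu
      have hne : u ≠ w := by rintro rfl; exact hu hDw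
      unfold Efac
      split_ifs with h
      · rw [h] at hne; exact hne.symm
      · rw [sub_ne_zero]; intro h2; apply hne; field_simp at h2; exact h2
    have gen : ∀ (E : ℂ → ℤ) (S : Finset ℂ), (∀ u, 0 ≤ E u) → (∀ u ∈ S, u ∈ T n) →
        (∀ u ∈ T n, E u ≠ 0 → u ∈ S) →
        Real.log ‖∏ u ∈ S, Efac u w ^ (E u).toNat‖ = ∑ u ∈ T n, (E u : ℝ) * Real.log ‖Efac u w‖ := by
      intro E S hE hST hTS
      rw [norm_prod, Real.log_prod]
      · have e : ∑ u ∈ S, Real.log ‖Efac u w ^ (E u).toNat‖ = ∑ u ∈ S, (E u : ℝ) * Real.log ‖Efac u w‖ := by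
          refine Finset.sum_congr rfl fun u _ => ?_
          rw [norm_pow, Real.log_pow]
          congr 1
          exact_mod_cast Int.toNat_of_nonneg (hE u)
        rw [e]
        refine Finset.sum_subset hST fun u hu huS => ?_
        have : E u = 0 := by
          by_contra h; exact huS (hTS u hu h)
        simp [this]
      · intro u hu
        rw [norm_ne_zero_iff]
        exact pow_ne_zero _ (hef u ((hT n u).1 (hST u hu)).1)
    rw [gen (fun u => D⁺ u) (S0 n) hp0 (fun u hu => Finset.mem_union_left _ hu)
        (fun u hu h => (hS0 n u).2 ⟨h, ((hT n u).1 hu).2⟩),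
      gen (fun u => D⁻ u) (S2 n) hq0 (fun u hu => Finset.mem_union_right _ hu)
        (fun u hu h => (hS2 n u).2 ⟨h, ((hT n u).1 hu).2⟩), ← Finset.sum_sub_distrib]
    refine Finset.sum_congr rfl fun u _ => ?_
    rw [← sub_mul, hDpm]
  set G : ℂ → ℂ := fun w => F w * h2 w / h0 w with hG
  have hLlim : ∀ w ∈ Metric.ball w0 ε, Tendsto L atTop (𝓝 (Real.log ‖G w‖)) := by
    intro w hw
    have a1 := ((t0 w).norm).log (norm_ne_zero_iff.2 (hn0 w hw))
    have a2 := ((t2 w).norm).log (norm_ne_zero_iff.2 (hn2 w hw))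
    have a3 := hL w hw
    have a4 := ((tendsto_const_nhds (x := Real.log ‖F w‖)).sub (a1.sub a2)).sub a3
    have e : Real.log ‖G w‖ = Real.log ‖F w‖ - (Real.log ‖h0 w‖ - Real.log ‖h2 w‖) - 0 := by
      have n1 := norm_ne_zero_iff.2 (hFn w hw)
      have n2 := norm_ne_zero_iff.2 (hn0 w hw)
      have n3 := norm_ne_zero_iff.2 (hn2 w hw)
      simp only [hG]
      rw [norm_div, norm_mul, Real.log_div (mul_ne_zero n1 n3) n2, Real.log_mul n1 n3]; ring
    rw [e]
    refine a4.congr fun n => ?_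
    rw [hlogs w hw n]; ring
  have hw0 : w0 ∈ Metric.ball w0 ε := Metric.mem_ball_self hε
  have hGne : ∀ w ∈ Metric.ball w0 ε, G w ≠ 0 := fun w hw =>
    div_ne_zero (mul_ne_zero (hFn w hw) (hn2 w hw)) (hn0 w hw)
  have hnorm : ∀ w ∈ Metric.ball w0 ε, ‖G w‖ = ‖G w0‖ := by
    intro w hw
    have := tendsto_nhds_unique (hLlim w hw) (hLlim w0 hw0)
    exact Real.log_injOn_pos (norm_pos_iff.2 (hGne w hw)) (norm_pos_iff.2 (hGne w0 hw0)) this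
  have hGd : DifferentiableOn ℂ G (Metric.ball w0 ε) := by
    intro w hw
    exact (((hFa w hw).differentiableAt.mul (d2 w)).div (d0 w) (hn0 w hw)).differentiableWithinAt
  have hconst := Complex.eqOn_of_isPreconnected_of_isMaxOn_norm
    (convex_ball w0 ε).isPreconnected Metric.isOpen_ball hGd hw0
    (fun w hw => by simp [hnorm w hw])
  refine ⟨G w0, hGne w0 hw0, fun w hw => ?_⟩
  have : G w = G w0 := hconst hw
  rw [← this]
  simp only [hG]
  rw [div_mul_cancel₀ _ (hn0 w hw)]

lemma MeromOn.tendsto_cob {f : ℂ → ℂ} {P : Set ℂ} (h : MeromOn f P univ) {p : ℂ} (hp : p ∈ P) :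
    Tendsto f (𝓝[≠] p) (Bornology.cobounded ℂ) := by
  rw [← tendsto_norm_atTop_iff_cobounded]; exact h.2.2.1 p hp

lemma MeromOn.eventually_notMem {f : ℂ → ℂ} {P : Set ℂ} (h : MeromOn f P univ) (p : ℂ) :
    ∀ᶠ z in 𝓝[≠] p, z ∉ P := by
  have := h.2.2.2 p (mem_univ p)
  rw [accPt_iff_frequently_nhdsNE] at this
  simpa using this

lemma MeromOn.analyticAt {f : ℂ → ℂ} {P : Set ℂ} (h : MeromOn f P univ) {p : ℂ} (hp : p ∉ P) :
    AnalyticAt ℂ f p := h.2.1 p ⟨mem_univ p, hp⟩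

lemma MeromOn.meromorphic {f : ℂ → ℂ} {P : Set ℂ} (h : MeromOn f P univ) : Meromorphic f := by
  intro p
  by_cases hp : p ∈ P
  · have hev := h.eventually_notMem p
    have hne : ∀ᶠ z in 𝓝[≠] p, f z ≠ 0 := by
      have := (h.2.2.1 p hp).eventually_gt_atTop 0
      filter_upwards [this] with z hz
      exact norm_pos_iff.1 hz
    set g : ℂ → ℂ := Function.update (fun z => (f z)⁻¹) p 0 with hg
    have hgt : Tendsto (fun z => (f z)⁻¹) (𝓝[≠] p) (𝓝 0) :=
      tendsto_inv₀_cobounded.comp (h.tendsto_cob hp)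
    have hga : AnalyticAt ℂ g p := by
      refine Complex.analyticAt_of_differentiable_on_punctured_nhds_of_continuousAt ?_ ?_
      · have : ∀ᶠ z in 𝓝[≠] p, z ≠ p := self_mem_nhdsWithin
        filter_upwards [hev, hne, this] with z h1 h2 h3
        have e : g =ᶠ[𝓝 z] fun z => (f z)⁻¹ := by
          filter_upwards [isOpen_ne.mem_nhds h3] with y hy
          exact Function.update_of_ne hy _ _
        exact (((h.analyticAt h1).differentiableAt).inv h2).congr_of_eventuallyEq e
      · rw [continuousAt_update_same]; exact hgt
    have hgm : MeromorphicAt g⁻¹ p := hga.meromorphicAt.inv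
    refine hgm.congr ?_
    have : ∀ᶠ z in 𝓝[≠] p, z ≠ p := self_mem_nhdsWithin
    filter_upwards [this] with z hz
    simp [hg, Function.update_of_ne hz]
  · exact (h.analyticAt hp).meromorphicAt

lemma MeromOn.order_neg {f : ℂ → ℂ} {P : Set ℂ} (h : MeromOn f P univ) {p : ℂ} (hp : p ∈ P) :
    meromorphicOrderAt f p < 0 :=
  (tendsto_cobounded_iff_meromorphicOrderAt_neg (h.meromorphic p)).1 (h.tendsto_cob hp)

lemma MeromOn.negPart_notMem {f : ℂ → ℂ} {P : Set ℂ} (h : MeromOn f P univ) {p : ℂ} (hp : p ∉ P) :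
    (MeromorphicOn.divisor f univ)⁻ p = 0 := by
  rw [Function.locallyFinsuppWithin.negPart_apply, negPart_eq_zero,
    MeromorphicOn.divisor_apply h.meromorphic.meromorphicOn (mem_univ p)]
  have := (h.analyticAt hp).meromorphicOrderAt_nonneg
  exact WithTop.untop₀_nonneg.2 this

lemma MeromOn.negPart_mem {f : ℂ → ℂ} {P : Set ℂ} (h : MeromOn f P univ) {p : ℂ} (hp : p ∈ P) :
    (MeromorphicOn.divisor f univ)⁻ p = poleOrder f p ∧ (MeromorphicOn.divisor f univ)⁻ p ≠ 0 := by
  have ho := h.order_neg hp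
  obtain ⟨k, hk⟩ := WithTop.ne_top_iff_exists.1 (ho.trans_le le_top).ne
  rw [← hk] at ho
  have hk0 : k < 0 := by exact_mod_cast ho
  have hD : (MeromorphicOn.divisor f univ)⁻ p = -k := by
    rw [Function.locallyFinsuppWithin.negPart_apply,
      MeromorphicOn.divisor_apply h.meromorphic.meromorphicOn (mem_univ p), ← hk]
    simp [negPart_def]; omega
  have hset : {m : ℕ | ∃ h : ℂ → ℂ, AnalyticAt ℂ h p ∧ h p ≠ 0 ∧
    ∀ᶠ w in 𝓝[≠] p, f w = h w / (w - p) ^ m} = {(-k).toNat} := by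
    ext m
    have e : (∃ h : ℂ → ℂ, AnalyticAt ℂ h p ∧ h p ≠ 0 ∧ ∀ᶠ w in 𝓝[≠] p, f w = h w / (w - p) ^ m) ↔
        meromorphicOrderAt f p = ((-m : ℤ) : WithTop ℤ) := by
      rw [meromorphicOrderAt_eq_int_iff (h.meromorphic p)]
      simp only [zpow_neg, zpow_natCast, smul_eq_mul, div_eq_inv_mul]
    rw [mem_ofPred_eq, e, ← hk, mem_singleton_iff, WithTop.coe_inj]
    omega
  rw [hD, poleOrder, hset, csInf_singleton]
  omega

lemma mProx_eq (f : ℂ → ℂ) (r : ℝ) : mProx f r = ValueDistribution.proximity f ⊤ r := by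
  rw [ValueDistribution.proximity_top, Real.circleAverage_def, mProx, smul_eq_mul]
  simp only [circleMap, zero_add]
  congr 2
  funext θ
  rw [Real.posLog_eq_log_max_one (norm_nonneg _)]

lemma MeromOn.nPoles_eq {f : ℂ → ℂ} {P : Set ℂ} (h : MeromOn f P univ) {r : ℝ} (W : Finset ℂ)
    (hW : ∀ u, u ∈ W ↔ (MeromorphicOn.divisor f univ)⁻ u ≠ 0 ∧ ‖u‖ ≤ r) {t : ℝ} (ht : t ≤ r) :
    nPoles f P t = ∑ u ∈ W, if ‖u‖ ≤ t then (((MeromorphicOn.divisor f univ)⁻ u : ℤ) : ℝ) else 0 := by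
  rw [nPoles, finsum_mem_def, finsum_eq_sum_of_support_subset (s := W)]
  · refine Finset.sum_congr rfl fun u hu => ?_
    have hP : u ∈ P := by
      by_contra hc; exact ((hW u).1 hu).1 (h.negPart_notMem hc)
    by_cases h1 : ‖u‖ ≤ t
    · rw [if_pos h1, indicator_of_mem (show u ∈ {z : ℂ | ‖z‖ ≤ t ∧ z ∈ P} from ⟨h1, hP⟩),
        (h.negPart_mem hP).1]
      simp
    · rw [if_neg h1, indicator_of_notMem]
      exact fun hc => h1 hc.1
  · intro u hu
    have hm := mem_of_indicator_ne_zero (Function.mem_support.1 hu)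
    exact (hW u).2 ⟨(h.negPart_mem hm.2).2, hm.1.trans ht⟩

lemma integral_ind {a r : ℝ} (ha : 0 < a) (har : a ≤ r) :
    IntervalIntegrable (fun t => if a ≤ t then t⁻¹ else 0) MeasureTheory.volume 0 r ∧
    ∫ t in (0:ℝ)..r, (if a ≤ t then t⁻¹ else 0) = Real.log (r * a⁻¹) := by
  have e : (fun t : ℝ => if a ≤ t then t⁻¹ else 0) = (Ici a).indicator fun t => t⁻¹ := by
    funext t; simp [indicator]
  have hset : Ioc 0 r ∩ Ici a = Icc a r := by
    ext t; simp only [mem_inter_iff, mem_Ioc, mem_Ici, mem_Icc]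
    constructor
    · rintro ⟨⟨_, h⟩, h2⟩; exact ⟨h2, h⟩
    · rintro ⟨h, h2⟩; exact ⟨⟨by linarith, h2⟩, h⟩
  have hr : 0 ≤ r := by linarith
  constructor
  · rw [intervalIntegrable_iff_integrableOn_Ioc_of_le hr, e]
    rw [MeasureTheory.IntegrableOn, MeasureTheory.integrable_indicator_iff measurableSet_Ici,
      MeasureTheory.IntegrableOn, MeasureTheory.Measure.restrict_restrict measurableSet_Ici, inter_comm, hset]
    refine ContinuousOn.integrableOn_Icc ?_
    exact continuousOn_id.inv₀ fun t ht => by have := ht.1; simp; linarith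
  · rw [e, intervalIntegral.integral_of_le hr, MeasureTheory.setIntegral_indicator measurableSet_Ici, hset,
      MeasureTheory.integral_Icc_eq_integral_Ioc, ← intervalIntegral.integral_of_le har,
      integral_inv_of_pos ha (by linarith), div_eq_mul_inv]

lemma MeromOn.NPoles_eq {f : ℂ → ℂ} {P : Set ℂ} (h : MeromOn f P univ) {r : ℝ} (hr : 1 ≤ r) :
    NPoles f P r = ValueDistribution.logCounting f ⊤ r := by
  classical
  rw [ValueDistribution.logCounting_top]
  set E := (MeromorphicOn.divisor f univ)⁻ with hE
  have hfin : {u | E u ≠ 0 ∧ ‖u‖ ≤ r}.Finite := by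
    refine ((Function.locallyFinsuppWithin.toClosedBall r E).finiteSupport
      (isCompact_closedBall 0 _)).subset ?_
    intro u hu
    rw [Function.mem_support, Function.locallyFinsuppWithin.toClosedBall_eval_within]
    · exact hu.1
    · simpa using hu.2.trans (le_abs_self r)
  set W := hfin.toFinset with hWd
  have hW : ∀ u, u ∈ W ↔ E u ≠ 0 ∧ ‖u‖ ≤ r := fun u => by simp [hWd]
  have hnp : ∀ t ≤ r, nPoles f P t = ∑ u ∈ W, if ‖u‖ ≤ t then ((E u : ℤ) : ℝ) else 0 :=
    fun t ht => h.nPoles_eq W hW ht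
  have h0 : nPoles f P 0 = E 0 := by
    rw [hnp 0 (by linarith)]
    have : ∀ u, (if ‖u‖ ≤ (0:ℝ) then ((E u : ℤ) : ℝ) else 0) = if u = 0 then ((E u : ℤ) : ℝ) else 0 := by
      intro u; simp
    simp only [this]
    rw [Finset.sum_ite_eq']
    split_ifs with h3
    · rfl
    · have : E 0 = 0 := by
        by_contra hc; exact h3 ((hW 0).2 ⟨hc, by simp; linarith⟩)
      simp [this]
  have hlc : Function.locallyFinsuppWithin.logCounting E r
      = ∑ u ∈ W, (E u : ℝ) * Real.log (r * ‖u‖⁻¹) + E 0 * Real.log r := by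
    simp only [Function.locallyFinsuppWithin.logCounting, AddMonoidHom.coe_mk, ZeroHom.coe_mk]
    congr 1
    rw [finsum_eq_sum_of_support_subset (s := W)]
    · refine Finset.sum_congr rfl fun u hu => ?_
      rw [Function.locallyFinsuppWithin.toClosedBall_eval_within]
      simpa using ((hW u).1 hu).2.trans (le_abs_self r)
    · intro u hu
      have h3 : Function.locallyFinsuppWithin.toClosedBall r E u ≠ 0 := by
        intro hc; apply hu; simp [hc]
      have h4 := Function.locallyFinsuppWithin.toClosedBall_support_subset_closedBall E h3
      rw [Function.locallyFinsuppWithin.toClosedBall_eval_within _ h4] at h3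
      refine (hW u).2 ⟨h3, ?_⟩
      simpa [abs_of_nonneg (by linarith : 0 ≤ r)] using h4
  rw [hlc, NPoles, h0]
  congr 1
  have hIntEq : ∫ t in (0:ℝ)..r, (nPoles f P t - (E 0 : ℝ)) / t =
      ∫ t in (0:ℝ)..r, ∑ u ∈ W, (if u = 0 then 0 else (E u : ℝ)) * (if ‖u‖ ≤ t then t⁻¹ else 0) := by
    refine intervalIntegral.integral_congr fun t ht => ?_
    rw [uIcc_of_le (by linarith)] at ht
    show (nPoles f P t - (E 0 : ℝ)) / t = _
    have e0 : (E 0 : ℝ) = ∑ u ∈ W, if u = 0 then ((E u : ℤ) : ℝ) else 0 := by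
      rw [Finset.sum_ite_eq']
      split_ifs with h3
      · rfl
      · have : E 0 = 0 := by
          by_contra hc; exact h3 ((hW 0).2 ⟨hc, by simp; linarith⟩)
        simp [this]
    rw [hnp t ht.2, e0, ← Finset.sum_sub_distrib, Finset.sum_div]
    refine Finset.sum_congr rfl fun u _ => ?_
    by_cases hu : u = 0
    · simp [hu, ht.1]
    · by_cases hut : ‖u‖ ≤ t <;> simp [hu, hut, div_eq_mul_inv]
  have hper : ∀ u ∈ W, IntervalIntegrable (fun t => (if u = 0 then 0 else (E u : ℝ)) * (if ‖u‖ ≤ t then t⁻¹ else 0)) MeasureTheory.volume 0 r ∧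
      ∫ t in (0:ℝ)..r, (if u = 0 then 0 else (E u : ℝ)) * (if ‖u‖ ≤ t then t⁻¹ else 0)
        = (E u : ℝ) * Real.log (r * ‖u‖⁻¹) := by
    intro u hu
    by_cases h0 : u = 0
    · simp [h0]
    · have := integral_ind (norm_pos_iff.2 h0) ((hW u).1 hu).2
      simp only [h0, if_false]
      refine ⟨this.1.const_mul _, ?_⟩
      rw [intervalIntegral.integral_const_mul, this.2]
  rw [hIntEq, intervalIntegral.integral_finsetSum fun u hu => (hper u hu).1]
  exact Finset.sum_congr rfl fun u hu => (hper u hu).2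

lemma MeromOn.Tchar_eq {f : ℂ → ℂ} {P : Set ℂ} (h : MeromOn f P univ) {r : ℝ} (hr : 1 ≤ r) :
    Tchar f P r = ValueDistribution.characteristic f ⊤ r := by
  rw [Tchar, mProx_eq, h.NPoles_eq hr]; rfl

lemma MeromOn.growth {f : ℂ → ℂ} {P : Set ℂ} (h : MeromOn f P univ) (ho : meromOrder f P < (1 : EReal)) :
    ∃ ρ R0 : ℝ, 0 ≤ ρ ∧ ρ < 1 ∧ 1 ≤ R0 ∧
      ∀ r, R0 ≤ r → ValueDistribution.characteristic f ⊤ r ≤ r ^ ρ := by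
  obtain ⟨b, hb1, hb2⟩ := EReal.lt_iff_exists_real_btwn.1 ho
  have hb2' : b < 1 := by exact_mod_cast hb2
  have hev := Filter.eventually_lt_of_limsup_lt hb1
  obtain ⟨R, hR⟩ := (hev.and (eventually_gt_atTop 1)).exists_forall_of_atTop
  refine ⟨max b 0, max R 1, le_max_right _ _, max_lt hb2' one_pos, le_max_right _ _, fun r hr => ?_⟩
  obtain ⟨h1, h2⟩ := hR r ((le_max_left _ _).trans hr)
  rw [← h.Tchar_eq h2.le]
  have h3 : Real.log (Tchar f P r) / Real.log r < b := by exact_mod_cast h1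
  have hl : 0 < Real.log r := Real.log_pos h2
  have hr0 : 0 < r := by linarith
  rcases le_or_gt (Tchar f P r) 0 with hT | hT
  · exact hT.trans (by positivity)
  · rw [div_lt_iff₀ hl] at h3
    have h4 : Tchar f P r ≤ r ^ b := by
      rw [Real.le_rpow_iff_log_le hT hr0]; exact h3.le
    exact h4.trans (Real.rpow_le_rpow_of_exponent_le h2.le (le_max_left _ _))

lemma growth_inv {F : ℂ → ℂ} (hF : Meromorphic F) {K ρ R0 : ℝ} (hρ : 0 ≤ ρ) (hR0 : 1 ≤ R0)
    (hg : ∀ r, R0 ≤ r → ValueDistribution.characteristic F ⊤ r ≤ K * r ^ ρ) :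
    ∃ K', 0 ≤ K' ∧ K ≤ K' ∧ ∀ r, R0 ≤ r → ValueDistribution.characteristic F⁻¹ ⊤ r ≤ K' * r ^ ρ := by
  set M := max |Real.log ‖F 0‖| |Real.log ‖meromorphicTrailingCoeffAt F 0‖| with hM
  have hM0 : 0 ≤ M := (abs_nonneg _).trans (le_max_left _ _)
  refine ⟨max K 0 + M, by positivity, ?_, fun r hr => ?_⟩
  · have := le_max_left K 0; linarith
  · have a := (abs_le.1 (ValueDistribution.characteristic_sub_characteristic_inv_le hF (R := r))).1
    have b := hg r hr
    have hr1 : 1 ≤ r ^ ρ := Real.one_le_rpow (hR0.trans hr) hρ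
    have c : K * r ^ ρ ≤ max K 0 * r ^ ρ := by gcongr; exact le_max_left _ _
    nlinarith

lemma growth_shift {F : ℂ → ℂ} (hF : Meromorphic F) {K ρ R0 : ℝ} (hρ : 0 ≤ ρ) (hR0 : 1 ≤ R0)
    (hg : ∀ r, R0 ≤ r → ValueDistribution.characteristic F ⊤ r ≤ K * r ^ ρ) :
    ∃ K', ∀ r, R0 ≤ r → ValueDistribution.characteristic (fun z => F z - 1) ⊤ r ≤ K' * r ^ ρ := by
  refine ⟨K + (Real.posLog ‖(1:ℂ)‖ + Real.log 2), fun r hr => ?_⟩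
  have a := (abs_le.1 (ValueDistribution.abs_characteristic_sub_characteristic_shift_le (a₀ := (1:ℂ)) hF (r := r))).1
  have b := hg r hr
  have hr1 : 1 ≤ r ^ ρ := Real.one_le_rpow (hR0.trans hr) hρ
  have hM : 0 ≤ Real.posLog ‖(1:ℂ)‖ + Real.log 2 :=
    add_nonneg Real.posLog_nonneg (Real.log_nonneg (by norm_num))
  nlinarith

lemma PhaseSeq.const_mul {ω c : ℂ} {x : ℕ → ℂ} (hc : c ≠ 0) (h : PhaseSeq ω x) :
    PhaseSeq ω (fun N => c * x N) := by
  rcases h with ⟨M, hM⟩ | ⟨y, η, h1, h2, h3, h4⟩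
  · exact Or.inl ⟨M, fun N hN => by simp [hM N hN]⟩
  · refine Or.inr ⟨fun N => c * y N, c / (‖c‖ : ℂ) * η, fun N => ?_, ?_, ?_, ?_⟩
    · simp only [h1]; ring
    · filter_upwards [h2] with N hN using mul_ne_zero hc hN
    · refine h3.congr fun N => ?_
      rw [mul_div_mul_left _ _ hc]
    · refine (h4.const_mul (c / (‖c‖ : ℂ))).congr fun N => ?_
      rw [norm_mul, Complex.ofReal_mul, div_mul_div_comm]

lemma PhaseSeq.dichotomy {ω : ℂ} {x : ℕ → ℂ} (hω : ω ≠ 0) (h : PhaseSeq ω x) :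
    (∃ M, ∀ N ≥ M, x N = 0) ∨ ∀ᶠ N in atTop, x N ≠ 0 := by
  rcases h with h | ⟨y, η, h1, h2, h3, h4⟩
  · exact Or.inl h
  · right
    filter_upwards [h2] with N hN
    rw [h1]; exact mul_ne_zero (pow_ne_zero _ hω) hN

lemma poly_of_eventually_zero {x : ℕ → ℂ} {h : ℂ → ℂ} (hx : ∀ z, HasSum (fun N => x N * z ^ N) (h z))
    (he : ∃ M, ∀ N ≥ M, x N = 0) : ∃ p : Polynomial ℂ, ∀ z, p.eval z = h z := by
  obtain ⟨M, hM⟩ := he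
  refine ⟨∑ N ∈ Finset.range M, Polynomial.C (x N) * Polynomial.X ^ N, fun z => ?_⟩
  have : HasSum (fun N => x N * z ^ N) (∑ N ∈ Finset.range M, x N * z ^ N) :=
    hasSum_sum_of_ne_finset_zero (fun N hN => by rw [hM N (by simpa using hN), zero_mul])
  rw [(hx z).unique this]
  simp [Polynomial.eval_finset_sum]

lemma coeffs_zero {x : ℕ → ℂ} (hx : ∀ z, HasSum (fun N => x N * z ^ N) 0) : ∀ N, x N = 0 := by
  have h1 := (hasFPS_of_hasSum (h := fun _ => 0) hx).hasFPowerSeriesAt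
  have h2 := h1.eq_zero
  rw [FormalMultilinearSeries.ofScalars_series_eq_zero] at h2
  intro N
  rw [h2]; rfl

lemma ray_ne {α β : ℝ} (h : Ray α ≠ Ray β) :
    -Complex.exp (-(α * Complex.I)) ≠ -Complex.exp (-(β * Complex.I)) := by
  intro he
  apply h
  rw [neg_inj, Complex.exp_neg, Complex.exp_neg, inv_inj] at he
  unfold Ray
  rw [he]

lemma ray_unit (α : ℝ) : ‖-Complex.exp (-(α * Complex.I))‖ = 1 := by
  rw [norm_neg, Complex.exp_neg, norm_inv, Complex.norm_exp_ofReal_mul_I, inv_one]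

lemma rational_of_local {f : ℂ → ℂ} {P : Set ℂ} (h : MeromOn f P univ) (hP : P.Countable)
    (p q : Polynomial ℂ) (hq : q ≠ 0) {z0 : ℂ} (hz0 : z0 ∉ P)
    (he : ∀ᶠ w in 𝓝 z0, f w * q.eval w = p.eval w) : IsRationalFn f P := by
  have hconn : IsPreconnected Pᶜ :=
    (hP.isPathConnected_compl_of_one_lt_rank (by simp [Complex.rank_real_complex])).isConnected.isPreconnected
  have ha : AnalyticOnNhd ℂ (fun w => f w * q.eval w - p.eval w) Pᶜ := fun w hw =>
    ((h.analyticAt hw).mul (AnalyticAt.aeval_polynomial analyticAt_id q)).sub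
      (AnalyticAt.aeval_polynomial analyticAt_id p)
  have := ha.eqOn_zero_of_preconnected_of_eventuallyEq_zero hconn hz0
    (he.mono fun w hw => by simp [hw])
  refine ⟨p, q, hq, fun z hz hqz => ?_⟩
  have e := this hz
  rw [eq_div_iff hqz]
  exact sub_eq_zero.1 e

lemma order_ne_top {f : ℂ → ℂ} {P : Set ℂ} (h : MeromOn f P univ) (hP : P.Countable)
    (hr : ¬ IsRationalFn f P) (a : ℂ) (u : ℂ) : meromorphicOrderAt (fun z => f z - a) u ≠ ⊤ := by
  intro ht
  rw [meromorphicOrderAt_eq_top_iff] at ht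
  apply hr
  have ht' : ∀ᶠ z in 𝓝[≠] u, ∀ᶠ w in 𝓝[≠] z, f w - a = 0 := by
    have := eventually_eventually_nhdsWithin.2 ht
    filter_upwards [this, self_mem_nhdsWithin] with z hz hzu
    refine hz.filter_mono ?_
    rw [nhdsWithin_eq_nhds.2 (isOpen_compl_singleton.mem_nhds hzu)]
    exact nhdsWithin_le_nhds
  obtain ⟨z, h1, h2⟩ := (ht'.and (h.eventually_notMem u)).exists
  refine rational_of_local h hP (Polynomial.C a) 1 one_ne_zero h2 ?_
  have hc : ContinuousAt (fun w => f w - a) z := (h.analyticAt h2).continuousAt.sub continuousAt_const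
  have hz : f z - a = 0 := by
    have h3 : Tendsto (fun w => f w - a) (𝓝[≠] z) (𝓝 0) :=
      tendsto_const_nhds.congr' (h1.mono fun w hw => hw.symm)
    exact tendsto_nhds_unique (hc.tendsto.mono_left nhdsWithin_le_nhds) h3
  have h4 := eventually_nhdsWithin_iff.1 h1
  filter_upwards [h4] with w hw
  by_cases hwz : w = z
  · subst hwz; simpa using sub_eq_zero.1 hz
  · simpa using sub_eq_zero.1 (hw hwz)

lemma EntPhase.differentiable {ω : ℂ} {h : ℂ → ℂ} (H : EntPhase ω h) : Differentiable ℂ h := by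
  obtain ⟨⟨x, hx, _⟩, _⟩ := H
  intro z
  exact ((hasFPS_of_hasSum hx).analyticAt_of_mem (by simp)).differentiableAt

/-- **Proposition 1.** There is no transcendental meromorphic function of order less than `1`
for which all but finitely many zeros lie on a ray `L₀`, all but finitely many `1`-points lie
on a ray `L₁`, and all but finitely many poles lie on a ray `L₂`, where `L₀, L₁, L₂` are three
distinct rays emanating from the origin. -/
theorem no_transcendental_merom_order_lt_one_three_rays
    (θ₀ θ₁ θ₂ : ℝ)
    (hd01 : Ray θ₀ ≠ Ray θ₁) (hd02 : Ray θ₀ ≠ Ray θ₂) (hd12 : Ray θ₁ ≠ Ray θ₂) :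
    ¬ ∃ (f : ℂ → ℂ) (P : Set ℂ), MeromOn f P Set.univ ∧ ¬ IsRationalFn f P ∧
      meromOrder f P < (1 : EReal) ∧
      ({z : ℂ | z ∉ P ∧ f z = 0} \ Ray θ₀).Finite ∧
      ({z : ℂ | z ∉ P ∧ f z = 1} \ Ray θ₁).Finite ∧
      (P \ Ray θ₂).Finite := by
  rintro ⟨f, P, h, hr, ho, hf0, hf1, hf2⟩
  have hF : Meromorphic f := h.meromorphic
  set F1 : ℂ → ℂ := fun z => f z - 1 with hF1d
  have hF1 : Meromorphic F1 := fun z => (hF z).sub (MeromorphicAt.const 1 z)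
  set D0 := MeromorphicOn.divisor f univ with hD0
  set D1 := MeromorphicOn.divisor F1 univ with hD1
  have hneg : D1⁻ = D0⁻ := by
    have := (hF.meromorphicOn (s := univ)).negPart_divisor_add_of_analyticNhdOn_right
      (f₂ := fun _ => (-1 : ℂ)) analyticOnNhd_const
    rw [hD0, ← this, hD1]
    congr 2
  obtain ⟨S0, hS0⟩ := exists_finsets D0⁺
  obtain ⟨S1, hS1⟩ := exists_finsets D1⁺
  obtain ⟨S2, hS2⟩ := exists_finsets D0⁻
  have hPn : ∀ u, u ∈ P ↔ D0⁻ u ≠ 0 := fun u =>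
    ⟨fun hu => (h.negPart_mem hu).2, fun hu => by
      by_contra hc; exact hu (h.negPart_notMem hc)⟩
  have hPc : P.Countable := by
    have : P ⊆ ⋃ n, (S2 n : Set ℂ) := by
      intro u hu
      obtain ⟨n, hn⟩ := exists_nat_ge ‖u‖
      exact mem_iUnion.2 ⟨n, (hS2 n u).2 ⟨(hPn u).1 hu, hn⟩⟩
    exact (countable_iUnion fun n => (S2 n).countable_toSet).mono this
  have hord0 : ∀ u, meromorphicOrderAt f u ≠ ⊤ := fun u => by
    simpa using order_ne_top h hPc hr 0 u
  have hord1 : ∀ u, meromorphicOrderAt F1 u ≠ ⊤ := order_ne_top h hPc hr 1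
  -- supports
  have hpm : ∀ (G : ℂ → ℂ), Meromorphic G → ∀ u, (MeromorphicOn.divisor G univ)⁺ u ≠ 0 →
      (MeromorphicOn.divisor G univ)⁻ u = 0 ∧ (AnalyticAt ℂ G u → G u = 0) := by
    intro G hG u hu
    rw [Function.locallyFinsuppWithin.posPart_apply] at hu
    rw [Function.locallyFinsuppWithin.negPart_apply]
    have hpos : 0 < MeromorphicOn.divisor G univ u := by
      by_contra hc
      exact hu (posPart_eq_zero.2 (not_lt.1 hc))
    refine ⟨negPart_eq_zero.2 hpos.le, fun ha => ?_⟩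
    by_contra hc
    have h0 : MeromorphicOn.divisor G univ u = 0 := by
      rw [MeromorphicOn.divisor_apply hG.meromorphicOn (mem_univ u)]
      have : meromorphicOrderAt G u = 0 := by
        rw [ha.meromorphicOrderAt_eq, ha.analyticOrderAt_eq_zero.2 hc]; rfl
      simp [this]
    omega
  have hsup0 : {u | D0⁺ u ≠ 0} ⊆ {z : ℂ | z ∉ P ∧ f z = 0} := by
    intro u hu
    have := hpm f hF u hu
    have hP : u ∉ P := fun hc => (hPn u).1 hc this.1
    exact ⟨hP, this.2 (h.analyticAt hP)⟩
  have hsup1 : {u | D1⁺ u ≠ 0} ⊆ {z : ℂ | z ∉ P ∧ f z = 1} := by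
    intro u hu
    have := hpm F1 hF1 u hu
    have hP : u ∉ P := fun hc => (hPn u).1 hc (by rw [← hneg]; exact this.1)
    exact ⟨hP, sub_eq_zero.1 (this.2 ((h.analyticAt hP).sub analyticAt_const))⟩
  have hsup2 : {u | D0⁻ u ≠ 0} ⊆ P := fun u hu => (hPn u).2 hu
  -- growth
  obtain ⟨ρ, R0, hρ0, hρ1, hR0, hg⟩ := h.growth ho
  have hg1 : ∀ r, R0 ≤ r → ValueDistribution.characteristic f ⊤ r ≤ 1 * r ^ ρ := by simpa using hg
  obtain ⟨Ka, hKa0, hKa1, hga⟩ := growth_inv hF hρ0 hR0 hg1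
  obtain ⟨Kb, hgb⟩ := growth_shift hF hρ0 hR0 hg1
  obtain ⟨Kc, hKc0, hKc1, hgc⟩ := growth_inv hF1 hρ0 hR0 hgb
  have up : ∀ {K K' : ℝ} (G : ℂ → ℂ), K ≤ K' → (∀ r, R0 ≤ r → ValueDistribution.characteristic G ⊤ r ≤ K * r ^ ρ) →
      ∀ r, R0 ≤ r → ValueDistribution.characteristic G ⊤ r ≤ K' * r ^ ρ := by
    intro K K' G hKK hh r hrr
    have : 0 ≤ r := by linarith
    exact (hh r hrr).trans (mul_le_mul_of_nonneg_right hKK (by positivity))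
  have hg1' := up f hKa1 hg1
  have hgb' := up F1 hKc1 hgb
  have lcle : ∀ {K : ℝ} (G : ℂ → ℂ), (∀ r, R0 ≤ r → ValueDistribution.characteristic G ⊤ r ≤ K * r ^ ρ) →
      ∀ r, R0 ≤ r → ValueDistribution.logCounting G ⊤ r ≤ K * r ^ ρ := by
    intro K G hh r hrr
    have a := hh r hrr
    have b : 0 ≤ ValueDistribution.proximity G ⊤ r := ValueDistribution.proximity_nonneg _
    simp only [ValueDistribution.characteristic, Pi.add_apply] at a
    linarith
  have l0 := lcle _ hga
  have l1 := lcle _ hgc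
  have l2 := lcle _ hg1'
  simp only [ValueDistribution.logCounting_inv, ValueDistribution.logCounting_zero, ← hD0] at l0
  simp only [ValueDistribution.logCounting_inv, ValueDistribution.logCounting_zero, ← hD1] at l1
  simp only [ValueDistribution.logCounting_top, ← hD0] at l2
  obtain ⟨h0, e0, t0⟩ := exists_ent D0⁺ (posPart_nonneg _) hKa0 hρ1 hR0 l0 θ₀
    (hf0.subset (diff_subset_diff_left hsup0)) S0 hS0
  obtain ⟨h1, e1, t1⟩ := exists_ent D1⁺ (posPart_nonneg _) hKc0 hρ1 hR0 l1 θ₁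
    (hf1.subset (diff_subset_diff_left hsup1)) S1 hS1
  obtain ⟨h2, e2, t2⟩ := exists_ent D0⁻ (negPart_nonneg _) hKa0 hρ1 hR0 l2 θ₂
    (hf2.subset (diff_subset_diff_left hsup2)) S2 hS2
  have d0 := e0.differentiable
  have d1 := e1.differentiable
  have d2 := e2.differentiable
  -- base point
  have nz0 := (meromorphicOrderAt_ne_top_iff_eventually_ne_zero (hF 0)).1 (hord0 0)
  have nz1 := (meromorphicOrderAt_ne_top_iff_eventually_ne_zero (hF1 0)).1 (hord1 0)
  obtain ⟨w0, ⟨⟨⟨⟨⟨a0, a1⟩, a2⟩, a3⟩, a4⟩, a5⟩⟩ :=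
    (((((e0.2.and e1.2).and e2.2).and (h.eventually_notMem 0)).and nz0).and nz1).exists
  have hfa : AnalyticAt ℂ f w0 := h.analyticAt a3
  have hev : ∀ᶠ w in 𝓝 w0, h0 w ≠ 0 ∧ h1 w ≠ 0 ∧ h2 w ≠ 0 ∧ AnalyticAt ℂ f w ∧ f w ≠ 0 ∧ F1 w ≠ 0 := by
    have hF1c : ContinuousAt F1 w0 := hfa.continuousAt.sub continuousAt_const
    filter_upwards [d0.continuous.continuousAt.eventually_ne a0, d1.continuous.continuousAt.eventually_ne a1,
      d2.continuous.continuousAt.eventually_ne a2, hfa.eventually_analyticAt,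
      hfa.continuousAt.eventually_ne a4, hF1c.eventually_ne a5] with w b0 b1 b2 b3 b4 b5
    exact ⟨b0, b1, b2, b3, b4, b5⟩
  obtain ⟨ε, hε, hball⟩ := Metric.eventually_nhds_iff_ball.1 hev
  obtain ⟨c, hc, hfc⟩ := factor_ball hF hord0 hKa0 hρ1 hR0 hg1' hga S0 S2 hS0 hS2 t0 t2 d0 d2 hε
    (fun w hw => (hball w hw).2.2.2.1) (fun w hw => (hball w hw).2.2.2.2.1)
    (fun w hw => (hball w hw).1) (fun w hw => (hball w hw).2.2.1)
  rw [← hneg] at hS2 t2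
  obtain ⟨c', hc', hfc'⟩ := factor_ball hF1 hord1 hKc0 hρ1 hR0 hgb' hgc S1 S2 hS1 hS2 t1 t2 d1 d2 hε
    (fun w hw => (hball w hw).2.2.2.1.sub analyticAt_const) (fun w hw => (hball w hw).2.2.2.2.2)
    (fun w hw => (hball w hw).2.1) (fun w hw => (hball w hw).2.2.1)
  -- global identity
  have hH : ∀ z, c * h0 z + -c' * h1 z + -1 * h2 z = 0 := by
    have ha : AnalyticOnNhd ℂ (fun z => c * h0 z + -c' * h1 z + -1 * h2 z) univ := by
      refine DifferentiableOn.analyticOnNhd (Differentiable.differentiableOn ?_) isOpen_univ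
      exact ((d0.const_mul c).add (d1.const_mul (-c'))).add (d2.const_mul (-1))
    have := ha.eqOn_zero_of_preconnected_of_eventuallyEq_zero isPreconnected_univ (mem_univ w0) (by
      filter_upwards [Metric.ball_mem_nhds w0 hε] with w hw
      have b1 := hfc w hw
      have b2 := hfc' w hw
      simp only [hF1d] at b2
      simp only [Pi.zero_apply]
      rw [← b1]
      linear_combination b2)
    exact fun z => this (mem_univ z)
  obtain ⟨⟨x0, s0, p0⟩, _⟩ := e0
  obtain ⟨⟨x1, s1, p1⟩, _⟩ := e1
  obtain ⟨⟨x2, s2, p2⟩, _⟩ := e2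
  have hcoef : ∀ N, c * x0 N + -c' * x1 N + -1 * x2 N = 0 := by
    refine coeffs_zero fun z => ?_
    rw [← hH z]
    have hs := (((s0 z).mul_left c).add ((s1 z).mul_left (-c'))).add ((s2 z).mul_left (-1))
    have he : (fun N => (c * x0 N + -c' * x1 N + -1 * x2 N) * z ^ N) =
        fun N => c * (x0 N * z ^ N) + -c' * (x1 N * z ^ N) + -1 * (x2 N * z ^ N) := by
      funext N
      ring
    rw [he]
    exact hs
  have hω : ∀ α : ℝ, -Complex.exp (-(α * Complex.I)) ≠ 0 := fun α => neg_ne_zero.2 (Complex.exp_ne_zero _)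
  have key : ¬ ((∀ᶠ N in atTop, x0 N ≠ 0) ∨ (∀ᶠ N in atTop, x1 N ≠ 0) ∨ (∀ᶠ N in atTop, x2 N ≠ 0)) := by
    intro hne
    refine three_phase (ray_unit θ₀) (ray_unit θ₁) (ray_unit θ₂) (ray_ne hd01) (ray_ne hd12) (ray_ne hd02.symm)
      (p0.const_mul hc) (p1.const_mul (neg_ne_zero.2 hc')) (p2.const_mul (neg_ne_zero.2 one_ne_zero)) hcoef ?_
    rcases hne with hh | hh | hh
    · exact Or.inl (hh.mono fun N hN => mul_ne_zero hc hN)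
    · exact Or.inr (Or.inl (hh.mono fun N hN => mul_ne_zero (neg_ne_zero.2 hc') hN))
    · exact Or.inr (Or.inr (hh.mono fun N hN => mul_ne_zero (neg_ne_zero.2 one_ne_zero) hN))
  push Not at key
  have z0 := (p0.dichotomy (hω θ₀)).resolve_right key.1
  have z2 := (p2.dichotomy (hω θ₂)).resolve_right key.2.2
  obtain ⟨q0, hq0⟩ := poly_of_eventually_zero s0 z0
  obtain ⟨q2, hq2⟩ := poly_of_eventually_zero s2 z2
  apply hr
  refine rational_of_local h hPc (Polynomial.C c * q0) q2 ?_ a3 ?_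
  · rintro rfl
    apply a2
    rw [← hq2]; simp
  · filter_upwards [Metric.ball_mem_nhds w0 hε] with w hw
    rw [hq2, hfc w hw, Polynomial.eval_mul, Polynomial.eval_C, hq0]
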